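/- There exists an absolute constant C > 0 such that for every n ≥ 2 and every normed space X = (ℝⁿ, ‖·‖) there exists an invertible linear map T : ℝⁿ → ℝⁿ with Var(‖TG‖) ≤ C · (E‖TG‖)² / (log n)², where G is a standard n-dimensional Gaussian vector. Equivalently, the parameter 𝔅(X) = min over T ∈ GL(n) of β(T B_X) satisfies 𝔅(X) ≤ C/(log n)². -/

import Mathlib

open MeasureTheory ProbabilityTheory Real

/-- The standard Gaussian measure `γₙ` on `ℝⁿ`. -/
noncomputable def stdGaussian (n : ℕ) : Measure (Fin n → ℝ) :=
  Measure.pi fun _ => gaussianReal 0 1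

section Cube

open scoped BigOperators

/-- The point of the discrete cube obtained by flipping the bit `b`. -/
def flipBit {B : Type*} [DecidableEq B] (b : B) (x : B → Bool) : B → Bool :=
  Function.update x b (!x b)

lemma flipBit_flipBit {B : Type*} [DecidableEq B] (b : B) (x : B → Bool) :
    flipBit b (flipBit b x) = x := by
  ext i
  by_cases h : i = b
  · subst h; simp [flipBit]
  · simp [flipBit, h]

/-- Flipping a bit as a permutation of the cube. -/
def flipEquiv {B : Type*} [DecidableEq B] (b : B) : (B → Bool) ≃ (B → Bool) where
  toFun := flipBit b
  invFun := flipBit b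
  left_inv := flipBit_flipBit b
  right_inv := flipBit_flipBit b

lemma expect_flipBit {B : Type*} [Fintype B] [DecidableEq B] (b : B) (F : (B → Bool) → ℝ) :
    𝔼 x, F (flipBit b x) = 𝔼 x, F x :=
  Fintype.expect_equiv (flipEquiv b) _ _ fun _ => rfl

/-- The Dirichlet form of the discrete cube. -/
noncomputable def cubeEnergy {B : Type*} [Fintype B] [DecidableEq B] (h : (B → Bool) → ℝ) : ℝ :=
  ∑ b, 𝔼 x, (h x - h (flipBit b x)) ^ 2

lemma cubeEnergy_equiv {α β : Type*} [Fintype α] [Fintype β] [DecidableEq α] [DecidableEq β]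
    (e : α ≃ β) (h : (β → Bool) → ℝ) :
    cubeEnergy (fun y : α → Bool => h (y ∘ e.symm)) = cubeEnergy h := by
  unfold cubeEnergy
  refine Fintype.sum_equiv e _ _ fun b => ?_
  refine Fintype.expect_equiv (e.arrowCongr (Equiv.refl Bool)) _ _ fun x => ?_
  have : flipBit b x ∘ e.symm = flipBit (e b) (x ∘ e.symm) := by
    ext i
    by_cases hi : i = e b
    · subst hi; simp [flipBit]
    · have h2 : e.symm i ≠ b := fun h => hi (by rw [← h]; simp)
      simp [flipBit, hi, h2]
  change (h (x ∘ e.symm) - h (flipBit b x ∘ e.symm)) ^ 2 = _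
  rw [this]
  rfl

/-- Prepend a bit. -/
def consBit {α : Type*} (c : Bool) (y : α → Bool) : Option α → Bool := fun o => o.elim c y

lemma expect_option {α : Type*} [Fintype α] [DecidableEq α] (F : (Option α → Bool) → ℝ) :
    𝔼 x, F x = (𝔼 y, F (consBit false y) + 𝔼 y, F (consBit true y)) / 2 := by
  have h1 : 𝔼 x, F x = 𝔼 p : Bool × (α → Bool), F (consBit p.1 p.2) := by
    refine Fintype.expect_equiv (Equiv.piOptionEquivProd (β := fun _ => Bool)) _ _ fun x => ?_
    congr 1
    ext o
    cases o <;> rfl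
  rw [h1, ← Finset.univ_product_univ, Finset.expect_product, Fintype.expect_eq_sum_div_card]
  simp [add_comm]

lemma flipBit_none {α : Type*} [DecidableEq α] (c : Bool) (y : α → Bool) :
    flipBit none (consBit c y) = consBit (!c) y := by
  ext o; cases o <;> simp [flipBit, consBit]

lemma flipBit_some {α : Type*} [DecidableEq α] (c : Bool) (b : α) (y : α → Bool) :
    flipBit (some b) (consBit c y) = consBit c (flipBit b y) := by
  ext o
  cases o with
  | none => simp [flipBit, consBit]
  | some a =>
    by_cases h : a = b
    · subst h; simp [flipBit, consBit]
    · simp [flipBit, consBit, h]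

lemma cubeEnergy_option {α : Type*} [Fintype α] [DecidableEq α] (h : (Option α → Bool) → ℝ) :
    cubeEnergy h = (cubeEnergy (fun y => h (consBit false y)) +
      cubeEnergy (fun y => h (consBit true y))) / 2 +
      𝔼 y, (h (consBit false y) - h (consBit true y)) ^ 2 := by
  unfold cubeEnergy
  rw [Fintype.sum_option]
  simp only [expect_option (α := α), flipBit_none, flipBit_some, ← Finset.sum_div,
    Finset.sum_add_distrib, Bool.not_false, Bool.not_true]
  have : 𝔼 y, (h (consBit true y) - h (consBit false y)) ^ 2 =
      𝔼 y, (h (consBit false y) - h (consBit true y)) ^ 2 :=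
    Finset.expect_congr rfl fun y _ => by ring
  rw [this]
  ring

/-- Tensorization of a two-point functional inequality over the discrete cube. -/
lemma cube_tensorization (φ ψ : ℝ → ℝ) (c : ℝ)
    (H : ∀ (α : Type) [Fintype α] [DecidableEq α] (h₀ h₁ : (α → Bool) → ℝ),
      (φ (𝔼 y, ψ (h₀ y)) + φ (𝔼 y, ψ (h₁ y))) / 2 -
        φ ((𝔼 y, ψ (h₀ y) + 𝔼 y, ψ (h₁ y)) / 2) ≤ c * 𝔼 y, (h₀ y - h₁ y) ^ 2)
    (B : Type) [Fintype B] [DecidableEq B] (h : (B → Bool) → ℝ) :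
    𝔼 x, φ (ψ (h x)) - φ (𝔼 x, ψ (h x)) ≤ c * cubeEnergy h := by
  revert h
  refine Fintype.induction_empty_option (P := fun B _ => ∀ (_ : DecidableEq B)
    (h : (B → Bool) → ℝ), 𝔼 x, φ (ψ (h x)) - φ (𝔼 x, ψ (h x)) ≤ c * cubeEnergy h) ?_ ?_ ?_ B inferInstance
  · intro α β _ e hα dβ h
    let _ : Fintype α := Fintype.ofEquiv β e.symm
    let _ : DecidableEq α := Classical.decEq α
    have h1 := hα inferInstance (fun y => h (y ∘ e.symm))
    have h2 : ∀ F : (β → Bool) → ℝ, 𝔼 y : α → Bool, F (y ∘ e.symm) = 𝔼 x, F x := fun F =>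
      Fintype.expect_equiv (e.arrowCongr (Equiv.refl Bool)) _ _ fun x => rfl
    rw [h2 (fun x => φ (ψ (h x))), h2 (fun x => ψ (h x)), cubeEnergy_equiv] at h1
    exact h1
  · intro _ h
    simp [cubeEnergy]
  · intro α _ hα d h
    let _ : DecidableEq α := Classical.decEq α
    obtain rfl : d = Option.instDecidableEq := Subsingleton.elim _ _
    rw [expect_option, expect_option, cubeEnergy_option]
    have h0 := hα inferInstance (fun y => h (consBit false y))
    have h1 := hα inferInstance (fun y => h (consBit true y))
    have h2 := H α (fun y => h (consBit false y)) (fun y => h (consBit true y))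
    linarith

lemma expect_mul_le_sqrt {α : Type*} (s : Finset α) (f g : α → ℝ) :
    𝔼 i ∈ s, f i * g i ≤ √(𝔼 i ∈ s, f i ^ 2) * √(𝔼 i ∈ s, g i ^ 2) := by
  rw [← Real.sqrt_mul (Finset.expect_nonneg fun _ _ => sq_nonneg _)]
  exact Real.le_sqrt_of_sq_le (Finset.expect_mul_sq_le_sq_mul_sq s f g)

lemma sq_expect_le {α : Type*} [Fintype α] [Nonempty α] (f : α → ℝ) :
    (𝔼 i, f i) ^ 2 ≤ 𝔼 i, f i ^ 2 := by
  simpa using Finset.expect_mul_sq_le_sq_mul_sq Finset.univ f (fun _ => 1)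

/-- The Poincaré inequality on the discrete cube. -/
theorem cube_poincare (B : Type) [Fintype B] [DecidableEq B] (h : (B → Bool) → ℝ) :
    𝔼 x, h x ^ 2 - (𝔼 x, h x) ^ 2 ≤ 1 / 4 * cubeEnergy h := by
  refine cube_tensorization (fun t => t ^ 2) (fun t => t) (1 / 4) ?_ B h
  intro α _ _ h₀ h₁
  have := sq_expect_le fun y => h₀ y - h₁ y
  rw [Finset.expect_sub_distrib] at this
  nlinarith

lemma two_point_entropy {a b : ℝ} (ha : 0 ≤ a) (hb : 0 ≤ b) :
    (a * log a + b * log b) / 2 - (a + b) / 2 * log ((a + b) / 2) ≤ a + b - 2 * (√a * √b) := by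
  rcases (add_nonneg ha hb).eq_or_lt with h0 | hpos
  · have h1 : a = 0 := by linarith
    have h2 : b = 0 := by linarith
    simp [h1, h2]
  set s := (a + b) / 2 with hs
  have hs0 : 0 < s := by positivity
  have key : ∀ t, 0 ≤ t → t * log t - t * log s ≤ t * (t / s - 1) := by
    intro t ht
    rcases ht.eq_or_lt with h | h
    · simp [← h]
    · rw [← mul_sub, ← Real.log_div h.ne' hs0.ne']
      exact mul_le_mul_of_nonneg_left (Real.log_le_sub_one_of_pos (by positivity)) h.le
  have h1 := key a ha
  have h2 := key b hb
  have h3 : (a * (a / s - 1) + b * (b / s - 1)) / 2 ≤ a + b - 2 * (√a * √b) := by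
    obtain ⟨u, hu, rfl⟩ : ∃ u, 0 ≤ u ∧ u ^ 2 = a := ⟨√a, Real.sqrt_nonneg _, Real.sq_sqrt ha⟩
    obtain ⟨v, hv, rfl⟩ : ∃ v, 0 ≤ v ∧ v ^ 2 = b := ⟨√b, Real.sqrt_nonneg _, Real.sq_sqrt hb⟩
    rw [Real.sqrt_sq hu, Real.sqrt_sq hv]
    have : (u ^ 2 * (u ^ 2 / s - 1) + v ^ 2 * (v ^ 2 / s - 1)) / 2 =
        (u - v) ^ 2 * ((u + v) ^ 2 / (2 * (u ^ 2 + v ^ 2))) := by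
      rw [hs]; field_simp; ring
    rw [this]
    have h4 : (u + v) ^ 2 / (2 * (u ^ 2 + v ^ 2)) ≤ 1 := by
      rw [div_le_one (by positivity)]; nlinarith [sq_nonneg (u - v)]
    nlinarith [mul_le_mul_of_nonneg_left h4 (sq_nonneg (u - v))]
  have h5 : s * log s = (a * log s + b * log s) / 2 := by rw [hs]; ring
  linarith

/-- The logarithmic Sobolev inequality on the discrete cube. -/
theorem cube_logSobolev (B : Type) [Fintype B] [DecidableEq B] (h : (B → Bool) → ℝ) :
    𝔼 x, h x ^ 2 * log (h x ^ 2) - (𝔼 x, h x ^ 2) * log (𝔼 x, h x ^ 2) ≤ cubeEnergy h := by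
  rw [← one_mul (cubeEnergy h)]
  refine cube_tensorization (fun t => t * log t) (fun t => t ^ 2) 1 ?_ B h
  intro α _ _ h₀ h₁
  refine (two_point_entropy (Finset.expect_nonneg fun _ _ => sq_nonneg _)
    (Finset.expect_nonneg fun _ _ => sq_nonneg _)).trans ?_
  have h1 := expect_mul_le_sqrt Finset.univ h₀ h₁
  have h2 : 𝔼 y, (h₀ y - h₁ y) ^ 2 = 𝔼 y, h₀ y ^ 2 + 𝔼 y, h₁ y ^ 2 - 2 * 𝔼 y, h₀ y * h₁ y := by
    rw [← Finset.expect_add_distrib, Finset.mul_expect, ← Finset.expect_sub_distrib]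
    exact Finset.expect_congr rfl fun y _ => by ring
  rw [h2]
  linarith

end Cube

section CondExpCube

open scoped BigOperators

variable {B : Type} [Fintype B] [DecidableEq B]

/-- Average over the bits outside `S`. -/
noncomputable def cubeCondExp (S : Finset B) (h : (B → Bool) → ℝ) (x : B → Bool) : ℝ :=
  𝔼 y, h (S.piecewise x y)

lemma cubeCondExp_univ (h : (B → Bool) → ℝ) : cubeCondExp Finset.univ h = h := by
  ext x; simp [cubeCondExp]

lemma cubeCondExp_empty (h : (B → Bool) → ℝ) (x : B → Bool) :
    cubeCondExp ∅ h x = 𝔼 y, h y := by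
  simp [cubeCondExp]

lemma cubeCondExp_sub (S : Finset B) (f g : (B → Bool) → ℝ) :
    cubeCondExp S (fun x => f x - g x) = fun x => cubeCondExp S f x - cubeCondExp S g x := by
  ext x; simp [cubeCondExp, Finset.expect_sub_distrib]

/-- Exchanging the bits outside `S` of two points of the cube. -/
def swapOutside (S : Finset B) : (B → Bool) × (B → Bool) ≃ (B → Bool) × (B → Bool) where
  toFun p := (S.piecewise p.1 p.2, S.piecewise p.2 p.1)
  invFun p := (S.piecewise p.1 p.2, S.piecewise p.2 p.1)
  left_inv p := by
    ext b <;> by_cases hb : b ∈ S <;> simp [hb]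
  right_inv p := by
    ext b <;> by_cases hb : b ∈ S <;> simp [hb]

lemma expect_swapOutside (S : Finset B) (F : (B → Bool) → (B → Bool) → ℝ) :
    𝔼 x, 𝔼 y, F (S.piecewise x y) (S.piecewise y x) = 𝔼 x, 𝔼 y, F x y := by
  have h := Fintype.expect_equiv (swapOutside S)
    (fun p => F (S.piecewise p.1 p.2) (S.piecewise p.2 p.1)) (fun p => F p.1 p.2) fun _ => rfl
  rwa [← Finset.univ_product_univ, Finset.expect_product, Finset.expect_product] at h

lemma cubeCondExp_selfAdjoint (S : Finset B) (g h : (B → Bool) → ℝ) :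
    𝔼 x, cubeCondExp S g x * h x = 𝔼 x, g x * cubeCondExp S h x := by
  simp only [cubeCondExp, Finset.expect_mul, Finset.mul_expect]
  rw [← expect_swapOutside S fun x y => g x * h (S.piecewise x y)]
  refine Finset.expect_congr rfl fun x _ => Finset.expect_congr rfl fun y _ => ?_
  congr 2
  ext b; by_cases hb : b ∈ S <;> simp [hb]

lemma expect_cubeCondExp (S : Finset B) (g : (B → Bool) → ℝ) :
    𝔼 x, cubeCondExp S g x = 𝔼 x, g x := by
  have h := cubeCondExp_selfAdjoint S g fun _ => 1
  simpa [cubeCondExp] using h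

lemma cubeCondExp_cubeCondExp {S T : Finset B} (hST : S ⊆ T) (g : (B → Bool) → ℝ) :
    cubeCondExp T (cubeCondExp S g) = cubeCondExp S g := by
  ext x
  unfold cubeCondExp
  rw [Finset.expect_congr rfl (g := fun _ => 𝔼 y, g (S.piecewise x y)), Fintype.expect_const]
  intro y _
  refine Finset.expect_congr rfl fun z _ => ?_
  congr 1
  ext b
  by_cases hb : b ∈ S
  · simp [hb, hST hb]
  · simp [hb]

lemma cubeCondExp_flipBit (S : Finset B) (b : B) (g : (B → Bool) → ℝ) (x : B → Bool) :
    cubeCondExp S (fun y => g (flipBit b y)) x = cubeCondExp S g (flipBit b x) := by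
  unfold cubeCondExp
  rw [← expect_flipBit b]
  refine Finset.expect_congr rfl fun y _ => congrArg g ?_
  ext c
  by_cases hc : c ∈ S <;> by_cases hcb : c = b
  · subst hcb; simp [flipBit, hc]
  · simp [flipBit, hc, hcb]
  · subst hcb; simp [flipBit, hc]
  · simp [flipBit, hc, hcb]

lemma expect_abs_cubeCondExp_le (S : Finset B) (g : (B → Bool) → ℝ) :
    𝔼 x, |cubeCondExp S g x| ≤ 𝔼 x, |g x| := by
  rw [← expect_cubeCondExp S fun x => |g x|]
  exact Finset.expect_le_expect fun x _ => Finset.abs_expect_le _ _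

/-- Martingale difference along the chain `S`. -/
noncomputable def cubeDiff (S : ℕ → Finset B) (f : (B → Bool) → ℝ) (j : ℕ) (x : B → Bool) : ℝ :=
  cubeCondExp (S (j + 1)) f x - cubeCondExp (S j) f x

lemma expect_cubeDiff_sq {S : ℕ → Finset B} (hS : Monotone S) (f : (B → Bool) → ℝ) (j : ℕ) :
    𝔼 x, cubeDiff S f j x ^ 2 =
      𝔼 x, f x * cubeCondExp (S (j + 1)) f x - 𝔼 x, f x * cubeCondExp (S j) f x := by
  have e : ∀ {S T : Finset B}, S ⊆ T →
      𝔼 x, cubeCondExp S f x * cubeCondExp T f x = 𝔼 x, f x * cubeCondExp S f x := by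
    intro S T h
    rw [← cubeCondExp_selfAdjoint, cubeCondExp_cubeCondExp h]
    exact Finset.expect_congr rfl fun x _ => mul_comm _ _
  have h1 := e (hS j.le_succ)
  have h2 := e (le_refl (S j))
  have h3 := e (le_refl (S (j + 1)))
  have h4 : 𝔼 x, cubeDiff S f j x ^ 2 =
      𝔼 x, cubeCondExp (S (j + 1)) f x * cubeCondExp (S (j + 1)) f x
        - 2 * 𝔼 x, cubeCondExp (S j) f x * cubeCondExp (S (j + 1)) f x
        + 𝔼 x, cubeCondExp (S j) f x * cubeCondExp (S j) f x := by
    rw [Finset.mul_expect, ← Finset.expect_sub_distrib, ← Finset.expect_add_distrib]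
    exact Finset.expect_congr rfl fun x _ => by simp only [cubeDiff]; ring
  rw [h4]
  simp only [Nat.succ_eq_add_one] at h1
  rw [h1, h2, h3]; ring

lemma sum_expect_cubeDiff_sq {S : ℕ → Finset B} (hS : Monotone S) (h0 : S 0 = ∅) {m : ℕ}
    (hm : S m = Finset.univ) (f : (B → Bool) → ℝ) :
    ∑ j ∈ Finset.range m, 𝔼 x, cubeDiff S f j x ^ 2 = 𝔼 x, f x ^ 2 - (𝔼 x, f x) ^ 2 := by
  simp only [expect_cubeDiff_sq hS]
  rw [Finset.sum_range_sub fun j => 𝔼 x, f x * cubeCondExp (S j) f x, h0, hm, cubeCondExp_univ]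
  simp only [cubeCondExp_empty, ← Finset.expect_mul, sq]

lemma sum_cubeEnergy_cubeDiff {S : ℕ → Finset B} (hS : Monotone S) (h0 : S 0 = ∅) {m : ℕ}
    (hm : S m = Finset.univ) (f : (B → Bool) → ℝ) :
    ∑ j ∈ Finset.range m, cubeEnergy (cubeDiff S f j) ≤ cubeEnergy f := by
  unfold cubeEnergy
  rw [Finset.sum_comm]
  refine Finset.sum_le_sum fun b _ => ?_
  have h := sum_expect_cubeDiff_sq hS h0 hm fun x => f x - f (flipBit b x)
  have e : ∀ j x, cubeDiff S (fun x => f x - f (flipBit b x)) j x =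
      cubeDiff S f j x - cubeDiff S f j (flipBit b x) := by
    intro j x
    simp only [cubeDiff, cubeCondExp_sub, cubeCondExp_flipBit]
    ring
  simp only [e] at h
  rw [h]
  linarith [sq_nonneg (𝔼 x, (f x - f (flipBit b x)))]

lemma entropy_lower_bound (d : (B → Bool) → ℝ) {K : ℝ} (hK : 0 < K) :
    (𝔼 x, d x ^ 2) * log K + 𝔼 x, d x ^ 2 - (𝔼 x, |d x|) ^ 2 * K ≤
      𝔼 x, d x ^ 2 * log (d x ^ 2) - (𝔼 x, d x ^ 2) * log (𝔼 x, d x ^ 2) := by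
  set p := 𝔼 x, d x ^ 2 with hp
  set q := 𝔼 x, |d x| with hq
  by_cases hd : d = 0
  · have hp0 : p = 0 := by rw [hp, hd]; simp
    have hq0 : q = 0 := by rw [hq, hd]; simp
    rw [hp0, hq0, hd]; simp
  obtain ⟨x₀, hx₀⟩ := Function.ne_iff.mp hd
  have hp0 : 0 < p := Finset.expect_pos' (fun _ _ => sq_nonneg _)
    ⟨x₀, Finset.mem_univ _, by have : d x₀ ≠ 0 := hx₀; positivity⟩
  have hq0 : 0 < q := Finset.expect_pos' (fun _ _ => abs_nonneg _)
    ⟨x₀, Finset.mem_univ _, by have : d x₀ ≠ 0 := hx₀; positivity⟩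
  have h1 : 2 * p * log (p / q) ≤ 𝔼 x, d x ^ 2 * log (d x ^ 2) := by
    have h2 : ∀ x, 2 * (d x ^ 2 * log (p / q) + (d x ^ 2 - |d x| * (p / q))) ≤
        d x ^ 2 * log (d x ^ 2) := by
      intro x
      by_cases hx : d x = 0
      · simp [hx]
      have ha : 0 < |d x| := abs_pos.mpr hx
      have h3 := Real.one_sub_inv_le_log_of_pos (x := |d x| / (p / q)) (by positivity)
      rw [Real.log_div ha.ne' (by positivity)] at h3
      have h4 : log (d x ^ 2) = 2 * log |d x| := by rw [← sq_abs, Real.log_pow]; norm_num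
      rw [h4]
      have h5 := mul_le_mul_of_nonneg_left h3 (sq_nonneg (d x))
      have h6 : d x ^ 2 * (1 - (|d x| / (p / q))⁻¹) = d x ^ 2 - |d x| * (p / q) := by
        rw [← sq_abs (d x)]; field_simp
      rw [h6] at h5
      linarith
    have h3 := Finset.expect_le_expect (s := Finset.univ) fun x _ => h2 x
    rw [← Finset.mul_expect, Finset.expect_add_distrib, Finset.expect_sub_distrib,
      ← Finset.expect_mul, ← Finset.expect_mul, ← hp, ← hq] at h3
    have : q * (p / q) = p := by field_simp
    rw [this] at h3
    linarith
  have h2 := Real.one_sub_inv_le_log_of_pos (x := p / q ^ 2 / K) (by positivity)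
  have h3 := mul_le_mul_of_nonneg_left h2 hp0.le
  rw [Real.log_div (by positivity) hK.ne', Real.log_div hp0.ne' (by positivity),
    Real.log_pow] at h3
  rw [Real.log_div hp0.ne' hq0.ne'] at h1
  have h4 : p * (1 - (p / q ^ 2 / K)⁻¹) = p - q ^ 2 * K := by field_simp
  rw [h4] at h3
  push_cast at h3
  linarith

/-- Falik–Samorodnitsky inequality on the cube, for an arbitrary filtration by blocks of bits. -/
theorem cube_falik_samorodnitsky {S : ℕ → Finset B} (hS : Monotone S) (h0 : S 0 = ∅) {m : ℕ}
    (hm : S m = Finset.univ) (f : (B → Bool) → ℝ) {A : ℝ} (hA : 0 < A)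
    (hle : ∑ j ∈ Finset.range m, (𝔼 x, |cubeDiff S f j x|) ^ 2 ≤ A) :
    (𝔼 x, f x ^ 2 - (𝔼 x, f x) ^ 2) * log ((𝔼 x, f x ^ 2 - (𝔼 x, f x) ^ 2) / A) ≤
      cubeEnergy f := by
  set V := 𝔼 x, f x ^ 2 - (𝔼 x, f x) ^ 2 with hV
  have hE : 0 ≤ cubeEnergy f :=
    Finset.sum_nonneg fun _ _ => Finset.expect_nonneg fun _ _ => sq_nonneg _
  have hV0 : 0 ≤ V := by have := sq_expect_le f; linarith
  rcases hV0.eq_or_lt with h | hVpos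
  · rw [← h]; simpa using hE
  have hK : 0 < V / A := by positivity
  have h1 := Finset.sum_le_sum fun j (_ : j ∈ Finset.range m) =>
    (entropy_lower_bound (cubeDiff S f j) hK).trans (cube_logSobolev B (cubeDiff S f j))
  rw [Finset.sum_sub_distrib, Finset.sum_add_distrib, ← Finset.sum_mul, ← Finset.sum_mul,
    sum_expect_cubeDiff_sq hS h0 hm, ← hV] at h1
  have h2 := sum_cubeEnergy_cubeDiff hS h0 hm f
  have h3 := mul_le_mul_of_nonneg_right hle hK.le
  have h4 : A * (V / A) = V := by field_simp
  linarith

lemma expect_abs_cubeDiff_le {S : ℕ → Finset B} (j : ℕ) (f g : (B → Bool) → ℝ)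
    (hg : ∀ x y, g ((S (j + 1)).piecewise x y) = g ((S j).piecewise x y)) :
    𝔼 x, |cubeDiff S f j x| ≤ 2 * 𝔼 x, |f x - g x| := by
  have e : ∀ x, cubeDiff S f j x = cubeCondExp (S (j + 1)) (fun x => f x - g x) x -
      cubeCondExp (S j) (fun x => f x - g x) x := by
    intro x
    have : cubeCondExp (S (j + 1)) g x = cubeCondExp (S j) g x := by
      simp only [cubeCondExp]
      exact Finset.expect_congr rfl fun y _ => hg x y
    simp only [cubeDiff, cubeCondExp_sub, this]
    ring
  calc 𝔼 x, |cubeDiff S f j x|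
      ≤ 𝔼 x, (|cubeCondExp (S (j + 1)) (fun x => f x - g x) x| +
          |cubeCondExp (S j) (fun x => f x - g x) x|) :=
        Finset.expect_le_expect fun x _ => by rw [e]; exact abs_sub _ _
    _ ≤ _ := by
        rw [Finset.expect_add_distrib, two_mul]
        exact add_le_add (expect_abs_cubeCondExp_le _ _) (expect_abs_cubeCondExp_le _ _)

end CondExpCube

section SeminormCube

open scoped BigOperators

/-- The sign `±1` encoded by a bit. -/
noncomputable def bitSign (b : Bool) : ℝ := if b then 1 else -1

/-- Normalized sums of signs. -/
noncomputable def cubePoint {n : ℕ} (N : ℕ) (x : Fin n × Fin N → Bool) : Fin n → ℝ :=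
  fun i => (√N)⁻¹ * ∑ k, bitSign (x (i, k))

lemma exists_support_functional {n : ℕ} (p : Seminorm ℝ (Fin n → ℝ)) (x : Fin n → ℝ) :
    ∃ u : Fin n → ℝ, (∀ z, ∑ i, u i * z i ≤ p z) ∧ ∑ i, u i * x i = p x := by
  have key : ∃ g : (Fin n → ℝ) →ₗ[ℝ] ℝ, g x = p x ∧ ∀ z, g z ≤ p z := by
    by_cases hx : x = 0
    · exact ⟨0, by simp [hx], fun z => by simp⟩
    let f : (Fin n → ℝ) →ₗ.[ℝ] ℝ := LinearPMap.mkSpanSingleton x (p x) hx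
    obtain ⟨g, hg1, hg2⟩ := exists_extension_of_le_sublinear f p
      (fun c hc z => by rw [map_smul_eq_mul, Real.norm_of_nonneg hc.le])
      (fun y z => map_add_le_add p y z) (by
        rintro ⟨z, hz⟩
        obtain ⟨c, rfl⟩ := Submodule.mem_span_singleton.mp hz
        rw [show f ⟨c • x, hz⟩ = c • p x from LinearPMap.mkSpanSingleton'_apply _ _ _ _ _,
          map_smul_eq_mul, smul_eq_mul]
        exact mul_le_mul_of_nonneg_right (le_abs_self c) (apply_nonneg p x))
    refine ⟨g, ?_, hg2⟩
    have h := hg1 ⟨x, Submodule.mem_span_singleton_self x⟩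
    rw [h]
    exact LinearPMap.mkSpanSingleton_apply ℝ ℝ hx (p x)
  obtain ⟨g, hgx, hg⟩ := key
  have e : ∀ z, ∑ i, g (Pi.single i 1) * z i = g z := by
    intro z
    conv_rhs => rw [pi_eq_sum_univ' z]
    simp only [map_sum, map_smul, smul_eq_mul]
    refine Finset.sum_congr rfl fun i _ => ?_
    rw [mul_comm]
  exact ⟨fun i => g (Pi.single i 1), fun z => (e z).trans_le (hg z), (e x).trans hgx⟩

lemma sum_sq_support_le_one {n : ℕ} {p : Seminorm ℝ (Fin n → ℝ)}
    (hp : ∀ x, p x ^ 2 ≤ ∑ i, x i ^ 2) {u : Fin n → ℝ} (hu : ∀ z, ∑ i, u i * z i ≤ p z) :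
    ∑ i, u i ^ 2 ≤ 1 := by
  have h1 := hu u
  have h2 := hp u
  simp only [← sq] at h1
  have h0 : 0 ≤ ∑ i, u i ^ 2 := Finset.sum_nonneg fun _ _ => sq_nonneg _
  by_contra! h
  nlinarith

lemma abs_bitSign_le (b : Bool) : |bitSign b| ≤ 1 := by cases b <;> simp [bitSign]

lemma cubePoint_flipBit {n N : ℕ} (x : Fin n × Fin N → Bool) (b : Fin n × Fin N) (i : Fin n) :
    cubePoint N (flipBit b x) i = cubePoint N x i -
      if i = b.1 then 2 * (√N)⁻¹ * bitSign (x b) else 0 := by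
  obtain ⟨j, l⟩ := b
  unfold cubePoint
  by_cases h : i = j
  · subst h
    have : ∑ k, bitSign (flipBit (i, l) x (i, k)) =
        ∑ k, bitSign (x (i, k)) - 2 * bitSign (x (i, l)) := by
      rw [← Finset.add_sum_erase _ _ (Finset.mem_univ l),
        ← Finset.add_sum_erase (a := l) _ (fun k => bitSign (x (i, k))) (Finset.mem_univ l)]
      have h1 : ∑ k ∈ Finset.univ.erase l, bitSign (flipBit (i, l) x (i, k)) =
          ∑ k ∈ Finset.univ.erase l, bitSign (x (i, k)) := by
        refine Finset.sum_congr rfl fun k hk => ?_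
        have : k ≠ l := Finset.ne_of_mem_erase hk
        simp [flipBit, this]
      have h2 : bitSign (flipBit (i, l) x (i, l)) = - bitSign (x (i, l)) := by
        cases hx : x (i, l) <;> simp [flipBit, bitSign, hx]
      rw [h1, h2]; ring
    rw [this]; simp; ring
  · have : ∀ k, flipBit (j, l) x (i, k) = x (i, k) := by
      intro k; simp [flipBit, h]
    simp [this, h]

/-- Energy bound for the pullback of a `1`-Lipschitz seminorm to the cube. -/
lemma cubeEnergy_seminorm_le {n N : ℕ} {p : Seminorm ℝ (Fin n → ℝ)}
    (hp : ∀ x, p x ^ 2 ≤ ∑ i, x i ^ 2) :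
    cubeEnergy (fun x : Fin n × Fin N → Bool => p (cubePoint N x)) ≤ 8 := by
  set F := fun x : Fin n × Fin N → Bool => p (cubePoint N x) with hF
  have h1 : ∀ b, 𝔼 x, (F x - F (flipBit b x)) ^ 2 =
      2 * 𝔼 x, (max (F x - F (flipBit b x)) 0) ^ 2 := by
    intro b
    have h2 := expect_flipBit b fun x => (max (F x - F (flipBit b x)) 0) ^ 2
    simp only [flipBit_flipBit] at h2
    rw [two_mul]
    nth_rewrite 2 [← h2]
    rw [← Finset.expect_add_distrib]
    refine Finset.expect_congr rfl fun x _ => ?_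
    rcases le_total (F x) (F (flipBit b x)) with h | h
    · rw [max_eq_right (by linarith), max_eq_left (by linarith)]; ring
    · rw [max_eq_left (by linarith), max_eq_right (by linarith)]; ring
  have h3 : ∀ x, ∑ b, (max (F x - F (flipBit b x)) 0) ^ 2 ≤ 4 := by
    intro x
    obtain ⟨u, hu, hux⟩ := exists_support_functional p (cubePoint N x)
    have hu1 := sum_sq_support_le_one hp hu
    have h4 : ∀ b : Fin n × Fin N, (max (F x - F (flipBit b x)) 0) ^ 2 ≤
        4 * ((N : ℝ)⁻¹ * u b.1 ^ 2) := by
      intro b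
      have h5 : F x - F (flipBit b x) ≤ |2 * (√N)⁻¹ * u b.1| := by
        have h6 := hu (cubePoint N (flipBit b x))
        simp only [cubePoint_flipBit, mul_sub, Finset.sum_sub_distrib, mul_ite, mul_zero,
          Finset.sum_ite_eq', Finset.mem_univ, if_true, hux] at h6
        have h7 : u b.1 * (2 * (√N)⁻¹ * bitSign (x b)) ≤ |2 * (√N)⁻¹ * u b.1| := by
          refine (le_abs_self _).trans ?_
          rw [show u b.1 * (2 * (√N)⁻¹ * bitSign (x b)) =
            2 * (√N)⁻¹ * u b.1 * bitSign (x b) by ring, abs_mul]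
          exact mul_le_of_le_one_right (abs_nonneg _) (abs_bitSign_le _)
        simp only [hF]
        have h8 : p (cubePoint N (flipBit b x)) = p fun i => cubePoint N x i -
            if i = b.1 then 2 * (√N)⁻¹ * bitSign (x b) else 0 := by
          congr 1; ext i; exact cubePoint_flipBit x b i
        rw [h8]
        simp only [funext fun i => cubePoint_flipBit x b i] at h6
        linarith
      calc (max (F x - F (flipBit b x)) 0) ^ 2 ≤ |2 * (√N)⁻¹ * u b.1| ^ 2 :=
            pow_le_pow_left₀ (le_max_right _ _) (max_le h5 (abs_nonneg _)) 2
        _ = 4 * ((N : ℝ)⁻¹ * u b.1 ^ 2) := by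
            rw [sq_abs, mul_pow, mul_pow, inv_pow, Real.sq_sqrt (Nat.cast_nonneg N)]; ring
    refine (Finset.sum_le_sum fun b _ => h4 b).trans ?_
    rw [← Finset.mul_sum, Fintype.sum_prod_type]
    simp only [Finset.sum_const, Finset.card_univ, Fintype.card_fin, nsmul_eq_mul]
    have h5 : ∑ i, (N : ℝ) * ((N : ℝ)⁻¹ * u i ^ 2) ≤ ∑ i, u i ^ 2 := by
      refine Finset.sum_le_sum fun i _ => ?_
      rw [← mul_assoc]
      exact mul_le_of_le_one_left (sq_nonneg _) mul_inv_le_one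
    linarith
  unfold cubeEnergy
  simp only [h1]
  rw [← Finset.mul_sum, ← Finset.expect_sum_comm]
  have h4 : 𝔼 x, ∑ b, (max (F x - F (flipBit b x)) 0) ^ 2 ≤ 4 :=
    Finset.expect_le Finset.univ_nonempty fun x _ => h3 x
  linarith

/-- The bits of the first `j` blocks. -/
def firstBlocks (n N j : ℕ) : Finset (Fin n × Fin N) := Finset.univ.filter fun b => b.1.val < j

lemma cube_seminorm_variance_le {n N : ℕ} {p : Seminorm ℝ (Fin n → ℝ)}
    (hp : ∀ x, p x ^ 2 ≤ ∑ i, x i ^ 2) :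
    𝔼 x : Fin n × Fin N → Bool, p (cubePoint N x) ^ 2 -
      (𝔼 x : Fin n × Fin N → Bool, p (cubePoint N x)) ^ 2 ≤ 2 := by
  have h1 := cube_poincare (Fin n × Fin N) fun x => p (cubePoint N x)
  have h2 := cubeEnergy_seminorm_le (N := N) hp
  linarith

lemma cube_seminorm_talagrand {n N : ℕ} {p : Seminorm ℝ (Fin n → ℝ)}
    (hp : ∀ x, p x ^ 2 ≤ ∑ i, x i ^ 2) {A : ℝ} (hA : 0 < A)
    (hle : ∑ j, (2 * 𝔼 x : Fin n × Fin N → Bool,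
      |p (cubePoint N x) - p (Function.update (cubePoint N x) j 0)|) ^ 2 ≤ A) :
    (𝔼 x : Fin n × Fin N → Bool, p (cubePoint N x) ^ 2 -
      (𝔼 x : Fin n × Fin N → Bool, p (cubePoint N x)) ^ 2) *
      log ((𝔼 x : Fin n × Fin N → Bool, p (cubePoint N x) ^ 2 -
      (𝔼 x : Fin n × Fin N → Bool, p (cubePoint N x)) ^ 2) / A) ≤ 8 := by
  refine (cube_falik_samorodnitsky (S := firstBlocks n N) (m := n) ?_ ?_ ?_
    (fun x => p (cubePoint N x)) hA ?_).trans (cubeEnergy_seminorm_le hp)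
  · intro j k hjk b hb
    simp only [firstBlocks, Finset.mem_filter, Finset.mem_univ, true_and] at hb ⊢
    omega
  · simp [firstBlocks]
  · ext b; simp [firstBlocks]
  · refine le_trans ?_ hle
    rw [Finset.sum_range]
    refine Finset.sum_le_sum fun j _ => ?_
    refine pow_le_pow_left₀ (Finset.expect_nonneg fun _ _ => abs_nonneg _) ?_ 2
    refine expect_abs_cubeDiff_le (j : ℕ) _ (fun x => p (Function.update (cubePoint N x) j 0)) ?_
    intro x y
    refine congrArg p ?_
    ext i
    by_cases hi : i = j
    · subst hi; simp
    · have hi' : i.val ≠ j.val := fun h => hi (Fin.ext h)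
      have : i ≤ j ↔ i < j := ⟨fun h => lt_of_le_of_ne h hi, le_of_lt⟩
      simp [hi, cubePoint, firstBlocks, Finset.piecewise, this]

end SeminormCube

section CentralLimit

open scoped BigOperators
open Filter Topology

/-- The uniform probability measure on the two bits. -/
noncomputable def bitMeasure : Measure Bool := (PMF.uniformOfFintype Bool).toMeasure

instance : IsProbabilityMeasure bitMeasure := by unfold bitMeasure; infer_instance

lemma bitMeasure_singleton (b : Bool) : bitMeasure {b} = 2⁻¹ := by
  simp [bitMeasure]

lemma integral_bitMeasure (f : Bool → ℝ) : ∫ b, f b ∂bitMeasure = (f true + f false) / 2 := by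
  rw [integral_fintype .of_finite]
  simp [Measure.real, bitMeasure_singleton]
  ring

/-- The law of a normalized sum of `N` independent signs. -/
noncomputable def walkLaw (N : ℕ) : Measure ℝ :=
  (Measure.pi fun _ : Fin N => bitMeasure).map fun w => (√N)⁻¹ * ∑ k, bitSign (w k)

lemma measurable_walk (N : ℕ) :
    Measurable fun w : Fin N → Bool => (√N)⁻¹ * ∑ k, bitSign (w k) := by
  refine Measurable.const_mul (Finset.measurable_sum _ fun k _ => ?_) _
  exact (measurable_of_countable bitSign).comp (measurable_pi_apply k)

instance (N : ℕ) : IsProbabilityMeasure (walkLaw N) :=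
  Measure.isProbabilityMeasure_map (measurable_walk N).aemeasurable

lemma map_bitSign_eval (N : ℕ) (k : Fin N) :
    (Measure.pi fun _ : Fin N => bitMeasure).map (fun w => bitSign (w k)) =
      bitMeasure.map bitSign := by
  conv_rhs => rw [← (measurePreserving_eval (fun _ : Fin N => bitMeasure) k).map_eq]
  exact (Measure.map_map (measurable_of_countable bitSign)
    (measurePreserving_eval (fun _ : Fin N => bitMeasure) k).measurable).symm

lemma iIndepFun_bitSign (N : ℕ) :
    iIndepFun (fun (k : Fin N) (w : Fin N → Bool) => bitSign (w k))
      (Measure.pi fun _ : Fin N => bitMeasure) :=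
  iIndepFun_pi (X := fun _ => bitSign) fun _ => (measurable_of_countable _).aemeasurable

lemma charFun_walkLaw (N : ℕ) (t : ℝ) :
    charFun (walkLaw N) t = charFun (bitMeasure.map bitSign) ((√N)⁻¹ * t) ^ N := by
  have hm : ∀ k : Fin N, Measurable fun w : Fin N → Bool => bitSign (w k) := fun k =>
    (measurable_of_countable bitSign).comp (measurable_pi_apply k)
  rw [walkLaw, charFun_map_mul_comp (Finset.measurable_sum _ fun k _ => hm k).aemeasurable,
    iIndepFun.charFun_map_fun_finsetSum_eq_prod (fun k _ => (hm k).aemeasurable)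
      ((iIndepFun_bitSign N).restrict _)]
  simp [map_bitSign_eval]

/-- `walkLaw` as a bundled probability measure. -/
noncomputable def walkProb (N : ℕ) : ProbabilityMeasure ℝ := ⟨walkLaw N, inferInstance⟩

/-- The standard Gaussian law as a bundled probability measure. -/
noncomputable def gaussProb : ProbabilityMeasure ℝ := ⟨gaussianReal 0 1, inferInstance⟩

lemma tendsto_walkLaw : Tendsto walkProb atTop (𝓝 gaussProb) := by
  refine ProbabilityMeasure.tendsto_iff_tendsto_charFun.2 fun t => ?_
  simp only [walkProb, gaussProb, ProbabilityMeasure.coe_mk, charFun_walkLaw, charFun_gaussianReal]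
  convert tendsto_charFun_inv_sqrt_mul_pow (P := bitMeasure) (X := bitSign)
    (measurable_of_countable _).aemeasurable ?_ ?_ t using 3
  · push_cast; ring
  · rw [integral_bitMeasure]; simp [bitSign]
  · rw [integral_bitMeasure]; simp [bitSign]

lemma mgf_walkLaw_le (N : ℕ) (t : ℝ) (ht : t ^ 2 = 1) : mgf id (walkLaw N) t ≤ exp (1 / 2) := by
  have hm : ∀ k : Fin N, Measurable fun w : Fin N → Bool => bitSign (w k) := fun k =>
    (measurable_of_countable bitSign).comp (measurable_pi_apply k)
  have h1 : mgf id (walkLaw N) t = mgf (∑ k, fun w : Fin N → Bool => bitSign (w k))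
      (Measure.pi fun _ : Fin N => bitMeasure) ((√N)⁻¹ * t) := by
    rw [walkLaw, mgf_id_map (measurable_walk N).aemeasurable, mgf, mgf]
    congr 1
    ext w
    simp only [Finset.sum_apply]
    congr 1; ring
  rw [h1, (iIndepFun_bitSign N).mgf_sum hm]
  have h2 : ∀ k : Fin N, mgf (fun w : Fin N → Bool => bitSign (w k))
      (Measure.pi fun _ : Fin N => bitMeasure) ((√N)⁻¹ * t) = cosh ((√N)⁻¹ * t) := by
    intro k
    rw [← mgf_id_map (hm k).aemeasurable, map_bitSign_eval,
      mgf_id_map (measurable_of_countable _).aemeasurable, mgf, integral_bitMeasure, cosh_eq]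
    simp [bitSign]
  simp only [h2, Finset.prod_const, Finset.card_univ, Fintype.card_fin]
  refine (pow_le_pow_left₀ (cosh_pos _).le (cosh_le_exp_half_sq _) N).trans ?_
  rw [← Real.exp_nat_mul, Real.exp_le_exp, mul_pow, inv_pow, Real.sq_sqrt (Nat.cast_nonneg N), ht]
  have := mul_inv_le_one (a := (N : ℝ))
  linarith

lemma pow_four_le_exp (x : ℝ) : x ^ 4 ≤ 24 * (exp (1 * x) + exp (-1 * x)) := by
  have h := Real.pow_div_factorial_le_exp |x| (abs_nonneg x) 4
  have h2 : exp |x| ≤ exp (1 * x) + exp (-1 * x) := by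
    rcases abs_cases x with ⟨h, _⟩ | ⟨h, _⟩ <;> rw [h]
    · simpa using (exp_pos (-x)).le
    · simpa using (exp_pos x).le
  have h3 : |x| ^ 4 = x ^ 4 := by rw [show (4 : ℕ) = 2 * 2 by rfl, pow_mul, sq_abs, ← pow_mul]
  rw [h3] at h
  norm_num [Nat.factorial] at h
  norm_num at h2 ⊢
  linarith

lemma integrable_pow_four_of_exp {μ : Measure ℝ}
    (h1 : Integrable (fun x => exp (1 * x)) μ) (h2 : Integrable (fun x => exp (-1 * x)) μ) :
    Integrable (fun x => x ^ 4) μ := by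
  refine ((h1.add h2).const_mul 24).mono' (by fun_prop) (ae_of_all _ fun x => ?_)
  rw [Real.norm_of_nonneg (by positivity)]
  exact pow_four_le_exp x

lemma integral_pow_four_le {μ : Measure ℝ}
    (h1 : Integrable (fun x => exp (1 * x)) μ) (h2 : Integrable (fun x => exp (-1 * x)) μ)
    (h3 : mgf id μ 1 ≤ exp (1 / 2)) (h4 : mgf id μ (-1) ≤ exp (1 / 2)) :
    ∫ x, x ^ 4 ∂μ ≤ 48 * exp (1 / 2) := by
  calc ∫ x, x ^ 4 ∂μ ≤ ∫ x, 24 * (exp (1 * x) + exp (-1 * x)) ∂μ :=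
        integral_mono (integrable_pow_four_of_exp h1 h2) ((h1.add h2).const_mul 24)
          pow_four_le_exp
    _ = 24 * (mgf id μ 1 + mgf id μ (-1)) := by
        rw [integral_const_mul, integral_add h1 h2]; rfl
    _ ≤ _ := by linarith

lemma integrable_exp_walkLaw (N : ℕ) (t : ℝ) : Integrable (fun x => exp (t * x)) (walkLaw N) := by
  rw [walkLaw, integrable_map_measure (by fun_prop) (measurable_walk N).aemeasurable]
  exact .of_finite

lemma mgf_gaussian_le (t : ℝ) (ht : t ^ 2 = 1) : mgf id (gaussianReal 0 1) t ≤ exp (1 / 2) := by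
  rw [mgf_gaussianReal (μ := 0) (v := 1) Measure.map_id t, ht]; simp

/-- A class of laws with uniformly bounded fourth moments. -/
structure FourthMomentLaw (μ : Measure ℝ) : Prop where
  integrable : Integrable (fun x => x ^ 4) μ
  integral_le : ∫ x, x ^ 4 ∂μ ≤ 48 * exp (1 / 2)

lemma fourthMomentLaw_walkLaw (N : ℕ) : FourthMomentLaw (walkLaw N) :=
  ⟨integrable_pow_four_of_exp (integrable_exp_walkLaw N 1) (integrable_exp_walkLaw N (-1)),
    integral_pow_four_le (integrable_exp_walkLaw N 1) (integrable_exp_walkLaw N (-1))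
    (mgf_walkLaw_le N 1 (by norm_num)) (mgf_walkLaw_le N (-1) (by norm_num))⟩

lemma fourthMomentLaw_gaussian : FourthMomentLaw (gaussianReal 0 1) :=
  ⟨integrable_pow_four_of_exp (integrable_exp_mul_gaussianReal 1)
    (integrable_exp_mul_gaussianReal (-1)),
    integral_pow_four_le (integrable_exp_mul_gaussianReal 1) (integrable_exp_mul_gaussianReal (-1))
    (mgf_gaussian_le 1 (by norm_num)) (mgf_gaussian_le (-1) (by norm_num))⟩

/-- Uniform bound for second moments of functions of quadratic growth. -/
noncomputable def quadraticBound (n : ℕ) : ℝ := (1 + n) * (1 + n * (48 * exp (1 / 2)))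

lemma sq_one_add_sum_sq_le {n : ℕ} (x : Fin n → ℝ) :
    (1 + ∑ i, x i ^ 2) ^ 2 ≤ (1 + n) * (1 + ∑ i, x i ^ 4) := by
  have h1 : (∑ i, x i ^ 2) ^ 2 ≤ n * ∑ i, x i ^ 4 := by
    have := sq_sum_le_card_mul_sum_sq (s := Finset.univ) (f := fun i => x i ^ 2)
    simpa [← pow_mul] using this
  have h3 : ∀ i, 2 * x i ^ 2 ≤ 1 + x i ^ 4 := fun i => by nlinarith [sq_nonneg (x i ^ 2 - 1)]
  have h4 := Finset.sum_le_sum fun i (_ : i ∈ Finset.univ) => h3 i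
  rw [← Finset.mul_sum, Finset.sum_add_distrib] at h4
  simp at h4
  nlinarith

lemma integrable_eval_pow_four {n : ℕ} {μ : Measure ℝ} [IsProbabilityMeasure μ]
    (hμ : FourthMomentLaw μ) (i : Fin n) :
    Integrable (fun x : Fin n → ℝ => x i ^ 4) (Measure.pi fun _ => μ) :=
  (measurePreserving_eval (fun _ : Fin n => μ) i).integrable_comp_of_integrable hμ.integrable

lemma integral_quartic_le {n : ℕ} {μ : Measure ℝ} [IsProbabilityMeasure μ]
    (hμ : FourthMomentLaw μ) :
    ∫ x, (1 + n) * (1 + ∑ i : Fin n, x i ^ 4) ∂(Measure.pi fun _ => μ) ≤ quadraticBound n := by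
  have hi := fun i => integrable_eval_pow_four (n := n) hμ i
  rw [integral_const_mul, integral_add (integrable_const _) (integrable_finsetSum _ fun i _ => hi i),
    integral_finsetSum _ fun i _ => hi i]
  have h2 : ∀ i : Fin n, ∫ x : Fin n → ℝ, x i ^ 4 ∂(Measure.pi fun _ => μ) ≤ 48 * exp (1 / 2) := by
    intro i
    refine le_of_eq_of_le ?_ hμ.integral_le
    conv_rhs => rw [← (measurePreserving_eval (fun _ : Fin n => μ) i).map_eq]
    rw [integral_map (measurable_pi_apply i).aemeasurable (by fun_prop)]
  have h3 := Finset.sum_le_sum fun i (_ : i ∈ Finset.univ) => h2 i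
  simp at h3
  unfold quadraticBound
  refine mul_le_mul_of_nonneg_left ?_ (by positivity)
  simpa using h3

lemma integrable_sq_of_quadratic {n : ℕ} {μ : Measure ℝ} [IsProbabilityMeasure μ]
    (hμ : FourthMomentLaw μ) {φ : (Fin n → ℝ) → ℝ} (hφ : Continuous φ)
    (hb : ∀ x, |φ x| ≤ 1 + ∑ i, x i ^ 2) :
    Integrable (fun x => φ x ^ 2) (Measure.pi fun _ => μ) ∧
      ∫ x, φ x ^ 2 ∂(Measure.pi fun _ => μ) ≤ quadraticBound n := by
  have hi : Integrable (fun x : Fin n → ℝ => (1 + n) * (1 + ∑ i : Fin n, x i ^ 4))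
      (Measure.pi fun _ => μ) :=
    ((integrable_const _).add
      (integrable_finsetSum _ fun i _ => integrable_eval_pow_four hμ i)).const_mul _
  have hle : ∀ x, φ x ^ 2 ≤ (1 + n) * (1 + ∑ i : Fin n, x i ^ 4) := fun x => by
    rw [← sq_abs]
    exact (pow_le_pow_left₀ (abs_nonneg _) (hb x) 2).trans (sq_one_add_sum_sq_le x)
  have h1 : Integrable (fun x => φ x ^ 2) (Measure.pi fun _ => μ) :=
    hi.mono' (by fun_prop) (ae_of_all _ fun x => by
      rw [Real.norm_of_nonneg (sq_nonneg _)]; exact hle x)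
  exact ⟨h1, (integral_mono h1 hi hle).trans (integral_quartic_le hμ)⟩

lemma integrable_of_quadratic {n : ℕ} {μ : Measure ℝ} [IsProbabilityMeasure μ]
    (hμ : FourthMomentLaw μ) {φ : (Fin n → ℝ) → ℝ} (hφ : Continuous φ)
    (hb : ∀ x, |φ x| ≤ 1 + ∑ i, x i ^ 2) : Integrable φ (Measure.pi fun _ => μ) := by
  refine ((integrable_sq_of_quadratic hμ hφ hb).1.add (integrable_const 1)).mono'
    (by fun_prop) (ae_of_all _ fun x => ?_)
  simp only [Pi.add_apply, Real.norm_eq_abs]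
  nlinarith [sq_abs (φ x), sq_nonneg (|φ x| - 1)]

/-- Truncation at level `R`. -/
noncomputable def truncate (R t : ℝ) : ℝ := max (-R) (min t R)

lemma abs_truncate_le {R : ℝ} (hR : 0 ≤ R) (t : ℝ) : |truncate R t| ≤ R := by
  rw [abs_le, truncate]
  exact ⟨le_max_left _ _, max_le (by linarith) (min_le_right _ _)⟩

lemma abs_sub_truncate_le {R : ℝ} (hR : 0 < R) (t : ℝ) : |t - truncate R t| ≤ t ^ 2 / R := by
  rw [le_div_iff₀ hR, truncate]
  rcases le_total t R with h | h
  · rw [min_eq_left h]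
    rcases le_total (-R) t with h' | h'
    · rw [max_eq_right h']; simp; positivity
    · rw [max_eq_left h', abs_of_nonpos (by linarith)]; nlinarith
  · rw [min_eq_right h, max_eq_right (by linarith), abs_of_nonneg (by linarith)]; nlinarith

lemma abs_integral_sub_truncate_le {n : ℕ} {μ : Measure ℝ} [IsProbabilityMeasure μ]
    (hμ : FourthMomentLaw μ) {φ : (Fin n → ℝ) → ℝ} (hφ : Continuous φ)
    (hb : ∀ x, |φ x| ≤ 1 + ∑ i, x i ^ 2) {R : ℝ} (hR : 0 < R) :
    |∫ x, φ x ∂(Measure.pi fun _ => μ) - ∫ x, truncate R (φ x) ∂(Measure.pi fun _ => μ)| ≤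
      quadraticBound n / R := by
  have hc : Continuous fun x => truncate R (φ x) := by unfold truncate; fun_prop
  have hi : Integrable (fun x => truncate R (φ x)) (Measure.pi fun _ : Fin n => μ) :=
    (integrable_const R).mono' hc.aestronglyMeasurable (ae_of_all _ fun x => abs_truncate_le hR.le _)
  obtain ⟨h1, h2⟩ := integrable_sq_of_quadratic hμ hφ hb
  rw [← integral_sub (integrable_of_quadratic hμ hφ hb) hi]
  refine (abs_integral_le_integral_abs).trans ?_
  calc _ ≤ ∫ x, φ x ^ 2 / R ∂(Measure.pi fun _ => μ) :=
        integral_mono ((integrable_of_quadratic hμ hφ hb).sub hi).abs (h1.div_const R)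
          fun x => abs_sub_truncate_le hR _
    _ ≤ _ := by rw [integral_div]; gcongr

/-- Multivariate central limit theorem for test functions of quadratic growth. -/
lemma tendsto_integral_walkLaw {n : ℕ} {φ : (Fin n → ℝ) → ℝ} (hφ : Continuous φ)
    (hb : ∀ x, |φ x| ≤ 1 + ∑ i, x i ^ 2) :
    Tendsto (fun N => ∫ x, φ x ∂(Measure.pi fun _ => walkLaw N)) atTop
      (𝓝 (∫ x, φ x ∂(_root_.stdGaussian n))) := by
  have hQ : 0 < quadraticBound n := by unfold quadraticBound; positivity
  have hweak : Tendsto (fun N => ProbabilityMeasure.pi fun _ : Fin n => walkProb N) atTop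
      (𝓝 (ProbabilityMeasure.pi fun _ : Fin n => gaussProb)) :=
    (ProbabilityMeasure.continuous_pi.tendsto _).comp (tendsto_pi_nhds.2 fun _ => tendsto_walkLaw)
  rw [ProbabilityMeasure.tendsto_iff_forall_integral_tendsto] at hweak
  rw [Metric.tendsto_atTop]
  intro ε hε
  set R := 4 * quadraticBound n / ε with hRdef
  have hR : 0 < R := by positivity
  have hRe : quadraticBound n / R = ε / 4 := by rw [hRdef]; field_simp
  have hc : Continuous fun x => truncate R (φ x) := by unfold truncate; fun_prop
  have h1 := hweak (BoundedContinuousFunction.ofNormedAddCommGroup _ hc R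
    fun x => abs_truncate_le hR.le _)
  rw [Metric.tendsto_atTop] at h1
  obtain ⟨N₀, hN₀⟩ := h1 (ε / 4) (by positivity)
  refine ⟨N₀, fun N hN => ?_⟩
  have h2 : dist (∫ x, truncate R (φ x) ∂(Measure.pi fun _ => walkLaw N))
      (∫ x, truncate R (φ x) ∂(Measure.pi fun _ => gaussianReal 0 1)) < ε / 4 := hN₀ N hN
  have h3 := abs_integral_sub_truncate_le (fourthMomentLaw_walkLaw N) hφ hb hR
  have h4 := abs_integral_sub_truncate_le fourthMomentLaw_gaussian hφ hb hR
  rw [hRe] at h3 h4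
  rw [Real.dist_eq] at h2 ⊢
  unfold _root_.stdGaussian
  rw [abs_lt] at h2 ⊢
  rw [abs_le] at h3 h4
  constructor <;> linarith

lemma integral_pi_walkLaw {n : ℕ} (N : ℕ) {φ : (Fin n → ℝ) → ℝ} (hφ : Continuous φ) :
    ∫ x, φ x ∂(Measure.pi fun _ => walkLaw N) =
      𝔼 x : Fin n × Fin N → Bool, φ (cubePoint N x) := by
  unfold walkLaw
  rw [← Measure.pi_map_pi fun _ => (measurable_walk N).aemeasurable,
    integral_map (measurable_of_countable _).aemeasurable hφ.aestronglyMeasurable,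
    integral_fintype .of_finite]
  rw [Fintype.expect_eq_sum_div_card, Finset.sum_div]
  refine Fintype.sum_equiv (Equiv.curry (Fin n) (Fin N) Bool).symm _ _ fun w => ?_
  simp only [Measure.real, Measure.pi_singleton, bitMeasure_singleton, Finset.prod_const,
    Finset.card_univ, Fintype.card_fin, smul_eq_mul]
  rw [div_eq_inv_mul]
  congr 1
  simp [← pow_mul, mul_comm]

lemma tendsto_expect_cubePoint {n : ℕ} {φ : (Fin n → ℝ) → ℝ} (hφ : Continuous φ)
    (hb : ∀ x, |φ x| ≤ 1 + ∑ i, x i ^ 2) :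
    Tendsto (fun N => 𝔼 x : Fin n × Fin N → Bool, φ (cubePoint N x)) atTop
      (𝓝 (∫ x, φ x ∂(_root_.stdGaussian n))) := by
  simpa only [integral_pi_walkLaw _ hφ] using tendsto_integral_walkLaw hφ hb

end CentralLimit

section GaussianConclusion

open scoped BigOperators
open Filter Topology

instance (n : ℕ) : IsProbabilityMeasure (_root_.stdGaussian n) := by
  unfold _root_.stdGaussian; infer_instance

lemma Seminorm.continuous_of_finiteDimensional {n : ℕ} (p : Seminorm ℝ (Fin n → ℝ)) :
    Continuous p :=
  (ConvexOn.locallyLipschitz p.convexOn).continuous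

variable {n : ℕ} {p : Seminorm ℝ (Fin n → ℝ)}

lemma seminorm_le_one_add (hp : ∀ x, p x ^ 2 ≤ ∑ i, x i ^ 2) (x : Fin n → ℝ) :
    p x ≤ 1 / 4 + ∑ i, x i ^ 2 := by
  nlinarith [hp x, sq_nonneg (p x - 1 / 2)]

lemma abs_seminorm_le (hp : ∀ x, p x ^ 2 ≤ ∑ i, x i ^ 2) (x : Fin n → ℝ) :
    |p x| ≤ 1 + ∑ i, x i ^ 2 := by
  rw [abs_of_nonneg (apply_nonneg p x)]; linarith [seminorm_le_one_add hp x]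

lemma abs_seminorm_sq_le (hp : ∀ x, p x ^ 2 ≤ ∑ i, x i ^ 2) (x : Fin n → ℝ) :
    |p x ^ 2| ≤ 1 + ∑ i, x i ^ 2 := by
  rw [abs_of_nonneg (sq_nonneg _)]; linarith [hp x]

lemma sum_sq_update_zero_le (x : Fin n → ℝ) (j : Fin n) :
    ∑ i, Function.update x j 0 i ^ 2 ≤ ∑ i, x i ^ 2 := by
  refine Finset.sum_le_sum fun i _ => ?_
  rcases eq_or_ne i j with rfl | h
  · simp [sq_nonneg]
  · simp [h]

lemma abs_seminorm_sub_update_le (hp : ∀ x, p x ^ 2 ≤ ∑ i, x i ^ 2) (j : Fin n)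
    (x : Fin n → ℝ) :
    |(|p x - p (Function.update x j 0)|)| ≤ 1 + ∑ i, x i ^ 2 := by
  rw [abs_abs, abs_le]
  have h1 := seminorm_le_one_add hp x
  have h2 := seminorm_le_one_add hp (Function.update x j 0)
  have h5 := sum_sq_update_zero_le x j
  have h3 := apply_nonneg p x
  have h4 := apply_nonneg p (Function.update x j 0)
  constructor <;> linarith

lemma integrable_stdGaussian {φ : (Fin n → ℝ) → ℝ} (hφ : Continuous φ)
    (hb : ∀ x, |φ x| ≤ 1 + ∑ i, x i ^ 2) : Integrable φ (_root_.stdGaussian n) :=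
  integrable_of_quadratic fourthMomentLaw_gaussian hφ hb

/-- The variance of a seminorm of a standard Gaussian vector. -/
noncomputable def gaussVar (p : Seminorm ℝ (Fin n → ℝ)) : ℝ :=
  (∫ x, p x ^ 2 ∂_root_.stdGaussian n) - (∫ x, p x ∂_root_.stdGaussian n) ^ 2

lemma tendsto_cube_variance (hp : ∀ x, p x ^ 2 ≤ ∑ i, x i ^ 2) :
    Tendsto (fun N => 𝔼 x : Fin n × Fin N → Bool, p (cubePoint N x) ^ 2 -
      (𝔼 x : Fin n × Fin N → Bool, p (cubePoint N x)) ^ 2) atTop (𝓝 (gaussVar p)) := by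
  have hc := p.continuous_of_finiteDimensional
  exact (tendsto_expect_cubePoint (hc.pow 2) (abs_seminorm_sq_le hp)).sub
    ((tendsto_expect_cubePoint hc (abs_seminorm_le hp)).pow 2)

lemma gaussVar_le_two (hp : ∀ x, p x ^ 2 ≤ ∑ i, x i ^ 2) : gaussVar p ≤ 2 :=
  le_of_tendsto (tendsto_cube_variance hp) (Eventually.of_forall fun _ =>
    cube_seminorm_variance_le hp)

lemma continuous_mul_log_div {A : ℝ} (hA : 0 < A) : Continuous fun v => v * log (v / A) := by
  have h : (fun v => v * log (v / A)) = fun v => A * ((v / A) * log (v / A)) := by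
    ext v; field_simp
  rw [h]
  exact (Real.continuous_mul_log.comp (continuous_id.div_const A)).const_mul A

/-- Talagrand's `L¹`-`L²` inequality for Gaussian seminorms. -/
lemma gaussVar_talagrand (hp : ∀ x, p x ^ 2 ≤ ∑ i, x i ^ 2) {A : ℝ} (hA : 0 < A)
    (hlt : ∑ j, (2 * ∫ x, |p x - p (Function.update x j 0)| ∂_root_.stdGaussian n) ^ 2 < A) :
    gaussVar p * log (gaussVar p / A) ≤ 8 := by
  have hc := p.continuous_of_finiteDimensional
  have h1 : Tendsto (fun N => ∑ j, (2 * 𝔼 x : Fin n × Fin N → Bool,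
      |p (cubePoint N x) - p (Function.update (cubePoint N x) j 0)|) ^ 2) atTop
      (𝓝 (∑ j, (2 * ∫ x, |p x - p (Function.update x j 0)| ∂_root_.stdGaussian n) ^ 2)) :=
    tendsto_finsetSum _ fun j _ => ((tendsto_expect_cubePoint
      (φ := fun x => |p x - p (Function.update x j 0)|) (by fun_prop)
      (abs_seminorm_sub_update_le hp j)).const_mul 2).pow 2
  refine le_of_tendsto (((continuous_mul_log_div hA).tendsto _).comp (tendsto_cube_variance hp)) ?_
  filter_upwards [h1.eventually_lt_const hlt] with N hN
  exact cube_seminorm_talagrand hp hA hN.le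

end GaussianConclusion

section Position

open scoped BigOperators
open Module

variable {E : Type*} [NormedAddCommGroup E] [InnerProductSpace ℝ E]

section Diagonal

variable {n : ℕ}

/-- The operator which acts diagonally in the basis `b`. -/
noncomputable def diagonalOp (b : OrthonormalBasis (Fin n) ℝ E) (c : Fin n → ℝ) : E →ₗ[ℝ] E :=
  Matrix.toLin b.toBasis b.toBasis (Matrix.diagonal c)

lemma diagonalOp_apply (b : OrthonormalBasis (Fin n) ℝ E) (c : Fin n → ℝ) (x : E) :
    diagonalOp b c x = ∑ i, (c i * b.repr x i) • b i := by
  rw [diagonalOp, Matrix.toLin_apply]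
  simp [Matrix.mulVec_diagonal]

lemma det_diagonalOp (b : OrthonormalBasis (Fin n) ℝ E) (c : Fin n → ℝ) :
    LinearMap.det (diagonalOp b c) = ∏ i, c i := by
  rw [diagonalOp, LinearMap.det_toLin, Matrix.det_diagonal]

lemma norm_sq_sum_smul_basis (b : OrthonormalBasis (Fin n) ℝ E) (a : Fin n → ℝ)
    (s : Finset (Fin n)) : ‖∑ i ∈ s, a i • b i‖ ^ 2 = ∑ i ∈ s, a i ^ 2 := by
  rw [← real_inner_self_eq_norm_sq, b.orthonormal.inner_sum]
  simp [sq]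

end Diagonal

variable [FiniteDimensional ℝ E]

lemma Seminorm.exists_mul_norm_le [Nontrivial E] (f : Seminorm ℝ E) (hf : Continuous f)
    (hdef : ∀ x, f x = 0 → x = 0) : ∃ c > 0, ∀ x, c * ‖x‖ ≤ f x := by
  obtain ⟨x₀, hx₀, hmin⟩ := (isCompact_sphere (0 : E) 1).exists_isMinOn
    (NormedSpace.sphere_nonempty.2 zero_le_one) hf.continuousOn
  have hx₀' : ‖x₀‖ = 1 := by simpa using hx₀
  refine ⟨f x₀, lt_of_le_of_ne (apply_nonneg _ _) fun h => ?_, fun x => ?_⟩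
  · rw [hdef _ h.symm] at hx₀'; simp at hx₀'
  · rcases eq_or_ne x 0 with rfl | hx
    · simp
    have hx' : 0 < ‖x‖ := norm_pos_iff.2 hx
    have h := hmin (show ‖x‖⁻¹ • x ∈ Metric.sphere (0 : E) 1 by simp [norm_smul, hx'.ne'])
    simp only [Set.mem_ofPred_eq, map_smul_eq_mul, norm_inv, norm_norm] at h
    calc f x₀ * ‖x‖ ≤ (‖x‖⁻¹ * f x) * ‖x‖ := by gcongr
      _ = f x := by field_simp

/-- Existence of a John-type position: a contraction of maximal determinant. -/
lemma exists_maximal_det [Nontrivial E] (f : Seminorm ℝ E) (hf : Continuous f)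
    (hdef : ∀ x, f x = 0 → x = 0) :
    ∃ T : E →L[ℝ] E, T.det ≠ 0 ∧ (∀ x, f (T x) ≤ ‖x‖) ∧
      ∀ S : E →L[ℝ] E, (∀ x, f (S x) ≤ ‖x‖) → |S.det| ≤ |T.det| := by
  obtain ⟨c, hc, hcf⟩ := f.exists_mul_norm_le hf hdef
  obtain ⟨C, hC, hCf⟩ := Seminorm.bound_of_continuous_normedSpace f hf
  set K : Set (E →L[ℝ] E) := {T | ∀ x, f (T x) ≤ ‖x‖} with hK
  have hcl : IsClosed K := by
    rw [hK, Set.ofPred_forall]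
    exact isClosed_iInter fun x =>
      isClosed_le (hf.comp (ContinuousLinearMap.apply ℝ E x).continuous) continuous_const
  have hbd : Bornology.IsBounded K := by
    refine isBounded_iff_forall_norm_le.2 ⟨c⁻¹, fun T hT => ?_⟩
    refine T.opNorm_le_bound (by positivity) fun x => ?_
    rw [← div_eq_inv_mul, le_div_iff₀' hc]
    exact (hcf _).trans (hT x)
  have hne : C⁻¹ • ContinuousLinearMap.id ℝ E ∈ K := fun x => by
    simp only [smul_apply, ContinuousLinearMap.id_apply, map_smul_eq_mul,
      norm_inv, Real.norm_of_nonneg hC.le]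
    rw [← div_eq_inv_mul, div_le_iff₀' hC]
    exact hCf x
  obtain ⟨T, hT, hmax⟩ := (Metric.isCompact_of_isClosed_isBounded hcl hbd).exists_isMaxOn ⟨_, hne⟩
    (ContinuousLinearMap.continuous_det.abs).continuousOn
  refine ⟨T, fun h0 => ?_, hT, fun S hS => hmax hS⟩
  have h1 : |(C⁻¹ • ContinuousLinearMap.id ℝ E).det| ≤ |T.det| := hmax hne
  rw [h0, abs_zero] at h1
  have h2 : (C⁻¹ • ContinuousLinearMap.id ℝ E).det = C⁻¹ ^ finrank ℝ E := by
    rw [ContinuousLinearMap.det, ContinuousLinearMap.toLinearMap_smul, LinearMap.det_smul]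
    simp
  rw [h2] at h1
  have : 0 < C⁻¹ ^ finrank ℝ E := by positivity
  rw [abs_of_pos this] at h1
  linarith

variable {n : ℕ} {f : Seminorm ℝ E}

lemma exists_unit_of_maximal (hf : ∀ x, f x ≤ ‖x‖)
    (hmax : ∀ S : E →L[ℝ] E, (∀ x, f (S x) ≤ ‖x‖) → |S.det| ≤ 1)
    (b : OrthonormalBasis (Fin n) ℝ E) (s : Finset (Fin n)) (hs : 2 * s.card < n) :
    ∃ x, ‖x‖ = 1 ∧ (∀ i ∈ s, inner ℝ (b i) x = 0) ∧ 1 / 2 ≤ f x := by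
  by_contra! hcon
  have hhalf : ∀ x, (∀ i ∈ s, inner ℝ (b i) x = 0) → f x ≤ ‖x‖ / 2 := by
    intro x hx
    rcases eq_or_ne x 0 with rfl | hx0
    · simp
    have hx' : 0 < ‖x‖ := norm_pos_iff.2 hx0
    have h := hcon (‖x‖⁻¹ • x) (by simp [norm_smul, hx'.ne']) fun i hi => by
      rw [inner_smul_right, hx i hi, mul_zero]
    simp only [map_smul_eq_mul, norm_inv, norm_norm] at h
    rw [← div_eq_inv_mul, div_lt_iff₀ hx'] at h
    linarith
  set c : Fin n → ℝ := fun i => if i ∈ s then (√2)⁻¹ else √2 with hc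
  have h2 : (0 : ℝ) < √2 := by positivity
  have hsq : √2 * √2 = 2 := Real.mul_self_sqrt (by norm_num)
  have hS : ∀ x, f (diagonalOp b c x) ≤ ‖x‖ := by
    intro x
    set u := ∑ i ∈ s, b.repr x i • b i with hu
    set v := ∑ i ∈ sᶜ, b.repr x i • b i with hv
    have h3 : diagonalOp b c x = (√2)⁻¹ • u + √2 • v := by
      rw [diagonalOp_apply, ← Finset.sum_add_sum_compl s, hu, hv, Finset.smul_sum, Finset.smul_sum]
      congr 1
      · exact Finset.sum_congr rfl fun i hi => by simp [hc, hi, smul_smul]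
      · exact Finset.sum_congr rfl fun i hi => by simp [hc, Finset.mem_compl.1 hi, smul_smul]
    have h4 : ‖x‖ ^ 2 = ‖u‖ ^ 2 + ‖v‖ ^ 2 := by
      rw [hu, hv, norm_sq_sum_smul_basis, norm_sq_sum_smul_basis, Finset.sum_add_sum_compl,
        ← norm_sq_sum_smul_basis b, b.sum_repr]
    have h5 : f v ≤ ‖v‖ / 2 := by
      refine hhalf v fun i hi => ?_
      rw [hv, inner_sum]
      refine Finset.sum_eq_zero fun j hj => ?_
      have : i ≠ j := fun h => Finset.mem_compl.1 hj (h ▸ hi)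
      rw [inner_smul_right, b.orthonormal.2 this, mul_zero]
    rw [h3]
    refine (map_add_le_add f _ _).trans ?_
    rw [map_smul_eq_mul, map_smul_eq_mul, norm_inv, Real.norm_of_nonneg h2.le]
    have h6 : √2 * f v ≤ (√2)⁻¹ * ‖v‖ := by
      rw [← div_eq_inv_mul, le_div_iff₀ h2, mul_right_comm, hsq]; linarith
    have h7 : (√2)⁻¹ * f u ≤ (√2)⁻¹ * ‖u‖ := by gcongr; exact hf u
    have h8 : (√2)⁻¹ * (‖u‖ + ‖v‖) ≤ ‖x‖ := by
      rw [← div_eq_inv_mul, div_le_iff₀ h2]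
      refine abs_le_of_sq_le_sq' ?_ (by positivity) |>.2
      rw [mul_pow, h4, Real.sq_sqrt (by norm_num)]
      nlinarith [sq_nonneg (‖u‖ - ‖v‖)]
    linarith
  have hdet := hmax (LinearMap.toContinuousLinearMap (diagonalOp b c)) hS
  rw [LinearMap.det_toContinuousLinearMap, det_diagonalOp] at hdet
  have hprod : ∏ i, c i = (√2)⁻¹ ^ s.card * √2 ^ (n - s.card) := by
    rw [← Finset.prod_mul_prod_compl s,
      Finset.prod_congr rfl (fun i hi => (by simp [hc, hi] : c i = (√2)⁻¹)),
      Finset.prod_congr rfl (fun i hi => (by simp [hc, Finset.mem_compl.1 hi] :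
        c i = √2)), Finset.prod_const, Finset.prod_const, Finset.card_compl, Fintype.card_fin]
  have hpow : (√2)⁻¹ ^ s.card * √2 ^ (n - s.card) = √2 ^ (n - 2 * s.card) := by
    rw [show n - s.card = (n - 2 * s.card) + s.card by omega, pow_add, inv_pow]
    field_simp
  rw [hprod, hpow, abs_of_pos (by positivity)] at hdet
  have h1 : 1 < √2 := by
    rw [Real.lt_sqrt] <;> norm_num
  exact absurd hdet (not_le.2 (one_lt_pow₀ h1 (by omega)))

lemma exists_basis_of_maximal (hn : finrank ℝ E = n) (hf : ∀ x, f x ≤ ‖x‖)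
    (hmax : ∀ S : E →L[ℝ] E, (∀ x, f (S x) ≤ ‖x‖) → |S.det| ≤ 1) (k : ℕ) (hk : 2 * k ≤ n + 1) :
    ∃ (b : OrthonormalBasis (Fin n) ℝ E) (s : Finset (Fin n)), s.card = k ∧
      ∀ i ∈ s, 1 / 2 ≤ f (b i) := by
  induction k with
  | zero => exact ⟨(stdOrthonormalBasis ℝ E).reindex (finCongr hn), ∅, by simp⟩
  | succ k ih =>
    obtain ⟨b, s, hs, hbs⟩ := ih (by omega)
    obtain ⟨x, hx1, hx2, hx3⟩ := exists_unit_of_maximal hf hmax b s (by omega)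
    obtain ⟨i₀, hi₀⟩ : ∃ i₀, i₀ ∉ s := by
      by_contra! h
      have := (Finset.eq_univ_iff_forall.2 h)
      rw [this] at hs
      simp at hs
      omega
    have hne : ∀ i ∈ s, i ≠ i₀ := fun i hi h => hi₀ (h ▸ hi)
    have hv : Orthonormal ℝ (((insert i₀ s : Finset (Fin n)) : Set (Fin n)).domRestrict
        (Function.update b i₀ x)) := by
      constructor
      · rintro ⟨i, hi⟩
        rcases Finset.mem_insert.1 (Finset.mem_coe.1 hi) with rfl | hi
        · simpa using hx1
        · simp [hne i hi]
      · rintro ⟨i, hi⟩ ⟨j, hj⟩ hij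
        have hij' : i ≠ j := fun h => hij (Subtype.ext h)
        rcases Finset.mem_insert.1 (Finset.mem_coe.1 hi) with h | h <;>
          rcases Finset.mem_insert.1 (Finset.mem_coe.1 hj) with h' | h'
        · exact absurd (h.trans h'.symm) hij'
        · simpa [hne j h', h, real_inner_comm] using hx2 j h'
        · simpa [hne i h, h'] using hx2 i h
        · simpa [hne i h, hne j h'] using b.orthonormal.2 hij'
    obtain ⟨b', hb'⟩ := hv.exists_orthonormalBasis_extension_of_card_eq (by simpa using hn)
    refine ⟨b', insert i₀ s, by rw [Finset.card_insert_of_notMem hi₀, hs], fun i hi => ?_⟩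
    rw [hb' i (Finset.mem_coe.2 hi)]
    rcases Finset.mem_insert.1 hi with rfl | hi
    · simpa using hx3
    · simpa [hne i hi] using hbs i hi

/-- Every norm has a position in which it is at most the Euclidean norm and at least half of the
coordinate vectors have norm at least `1/2`. -/
lemma exists_position {n : ℕ} (hn : 0 < n) (p : Seminorm ℝ (Fin n → ℝ))
    (hdef : ∀ x, p x = 0 → x = 0) :
    ∃ (T : (Fin n → ℝ) ≃ₗ[ℝ] (Fin n → ℝ)) (J : Finset (Fin n)), n ≤ 2 * J.card ∧
      (∀ x, p (T x) ^ 2 ≤ ∑ i, x i ^ 2) ∧ ∀ j ∈ J, 1 / 2 ≤ p (T (Pi.single j 1)) := by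
  let e : EuclideanSpace ℝ (Fin n) ≃ₗ[ℝ] (Fin n → ℝ) := WithLp.linearEquiv 2 ℝ (Fin n → ℝ)
  have : Nonempty (Fin n) := ⟨⟨0, hn⟩⟩
  let f₀ : Seminorm ℝ (EuclideanSpace ℝ (Fin n)) := p.comp e.toLinearMap
  have hf₀ : Continuous f₀ := p.continuous_of_finiteDimensional.comp
    (LinearMap.continuous_of_finiteDimensional e.toLinearMap)
  obtain ⟨T, hdet, hT, hmax⟩ := exists_maximal_det f₀ hf₀ fun x hx => by
    simpa using hdef _ hx
  let f : Seminorm ℝ (EuclideanSpace ℝ (Fin n)) := f₀.comp T.toLinearMap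
  obtain ⟨b, s, hs, hbs⟩ := exists_basis_of_maximal (f := f) (n := n) (by simp) hT (fun S hS => by
    have h := hmax (T.comp S) hS
    have h2 : (T.comp S).det = T.det * S.det := by
      simp only [ContinuousLinearMap.det, ContinuousLinearMap.toLinearMap_comp, LinearMap.det_comp]
    rw [h2, abs_mul] at h
    exact le_of_mul_le_mul_left (by simpa using h) (abs_pos.2 hdet)) ((n + 1) / 2) (by omega)
  let Te : EuclideanSpace ℝ (Fin n) ≃ₗ[ℝ] EuclideanSpace ℝ (Fin n) :=
    LinearEquiv.ofIsUnitDet (f := T.toLinearMap) (v := b.toBasis) (v' := b.toBasis)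
      (by rw [LinearMap.det_toMatrix]; exact isUnit_iff_ne_zero.2 hdet)
  refine ⟨e.symm.trans (b.repr.symm.toLinearEquiv.trans (Te.trans e)), s, by omega, fun x => ?_,
    fun j hj => ?_⟩
  · have h1 : p (e (T (b.repr.symm (e.symm x)))) ≤ ‖b.repr.symm (e.symm x)‖ := hT _
    rw [LinearIsometryEquiv.norm_map] at h1
    have h2 : ‖e.symm x‖ ^ 2 = ∑ i, x i ^ 2 := by
      rw [EuclideanSpace.real_norm_sq_eq]; rfl
    rw [← h2]
    exact pow_le_pow_left₀ (apply_nonneg _ _) h1 2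
  · have h1 : 1 / 2 ≤ p (e (T (b j))) := hbs j hj
    have h2 : b.repr.symm (e.symm (Pi.single j 1)) = b j := by
      rw [← b.repr_symm_single]; rfl
    have h3 : p (e (T (b.repr.symm (e.symm (Pi.single j 1))))) = p (e (T (b j))) := by rw [h2]
    exact h1.trans h3.ge

end Position

section Restriction

open scoped BigOperators

variable {n : ℕ}

/-- Restriction of a vector to a set of coordinates. -/
def restrictCoord (S : Finset (Fin n)) : (Fin n → ℝ) →ₗ[ℝ] (Fin n → ℝ) where
  toFun x i := if i ∈ S then x i else 0
  map_add' x y := by ext i; by_cases h : i ∈ S <;> simp [h]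
  map_smul' r x := by ext i; by_cases h : i ∈ S <;> simp [h]

lemma restrictCoord_apply (S : Finset (Fin n)) (x : Fin n → ℝ) (i : Fin n) :
    restrictCoord S x i = if i ∈ S then x i else 0 := rfl

lemma sum_mul_restrictCoord (S : Finset (Fin n)) (u x : Fin n → ℝ) :
    ∑ i, u i * restrictCoord S x i = ∑ i ∈ S, u i * x i := by
  simp [restrictCoord_apply]

lemma restrictCoord_update {S : Finset (Fin n)} (x : Fin n → ℝ) (j : Fin n) :
    restrictCoord S (Function.update x j 0) = restrictCoord (S.erase j) x := by
  ext i
  rcases eq_or_ne i j with rfl | h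
  · simp [restrictCoord_apply]
  · simp [restrictCoord_apply, h]

lemma comp_restrictCoord_sq_le {p : Seminorm ℝ (Fin n → ℝ)} (hp : ∀ x, p x ^ 2 ≤ ∑ i, x i ^ 2)
    (S : Finset (Fin n)) (x : Fin n → ℝ) : p.comp (restrictCoord S) x ^ 2 ≤ ∑ i, x i ^ 2 := by
  refine (hp _).trans (Finset.sum_le_sum fun i _ => ?_)
  rw [restrictCoord_apply]
  split_ifs
  · exact le_rfl
  · simp [sq_nonneg]

/-- The Gaussian mean of a seminorm. -/
noncomputable def gaussMean (p : Seminorm ℝ (Fin n → ℝ)) : ℝ := ∫ x, p x ∂_root_.stdGaussian n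

lemma gaussMean_nonneg (p : Seminorm ℝ (Fin n → ℝ)) : 0 ≤ gaussMean p :=
  integral_nonneg fun _ => apply_nonneg _ _

lemma integrable_seminorm {p : Seminorm ℝ (Fin n → ℝ)} (hp : ∀ x, p x ^ 2 ≤ ∑ i, x i ^ 2) :
    Integrable p (_root_.stdGaussian n) :=
  integrable_stdGaussian p.continuous_of_finiteDimensional (abs_seminorm_le hp)

lemma measurePreserving_sign {ε : Fin n → ℝ} (hε : ∀ i, ε i = 1 ∨ ε i = -1) :
    MeasurePreserving (fun x i => ε i * x i) (_root_.stdGaussian n) (_root_.stdGaussian n) := by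
  refine measurePreserving_pi _ _ fun i => ⟨measurable_const_mul _, ?_⟩
  rw [gaussianReal_map_const_mul]
  rcases hε i with h | h <;> simp [h]

lemma integral_sign {ε : Fin n → ℝ} (hε : ∀ i, ε i = 1 ∨ ε i = -1) {f : (Fin n → ℝ) → ℝ}
    (hf : Continuous f) :
    ∫ x, f (fun i => ε i * x i) ∂_root_.stdGaussian n = ∫ x, f x ∂_root_.stdGaussian n := by
  conv_rhs => rw [← (measurePreserving_sign hε).map_eq]
  rw [integral_map (measurePreserving_sign hε).measurable.aemeasurable hf.aestronglyMeasurable]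

lemma bitSign_eq (b : Bool) : bitSign b = 1 ∨ bitSign b = -1 := by cases b <;> simp [bitSign]

lemma gaussMean_restrictCoord_mono {p : Seminorm ℝ (Fin n → ℝ)}
    (hp : ∀ x, p x ^ 2 ≤ ∑ i, x i ^ 2) {S I : Finset (Fin n)} (h : S ⊆ I) :
    gaussMean (p.comp (restrictCoord S)) ≤ gaussMean (p.comp (restrictCoord I)) := by
  set ε : Fin n → ℝ := fun i => if i ∈ S then 1 else -1 with hε
  have hε' : ∀ i, ε i = 1 ∨ ε i = -1 := fun i => by by_cases hi : i ∈ S <;> simp [hε, hi]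
  set q := p.comp (restrictCoord I) with hq
  have hqi := integrable_seminorm (comp_restrictCoord_sq_le hp I)
  have hqi' : Integrable (fun x => q (fun i => ε i * x i)) (_root_.stdGaussian n) :=
    (measurePreserving_sign hε').integrable_comp_of_integrable hqi
  have hle : ∀ x, p.comp (restrictCoord S) x ≤ (1 / 2) * (q x + q (fun i => ε i * x i)) := by
    intro x
    have h1 : restrictCoord S x =
        (1 / 2 : ℝ) • (restrictCoord I x + restrictCoord I (fun i => ε i * x i)) := by
      ext i
      by_cases hi : i ∈ S
      · simp [restrictCoord_apply, hε, hi, h hi]; ring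
      · by_cases hI : i ∈ I <;> simp [restrictCoord_apply, hε, hi, hI]
    rw [Seminorm.comp_apply, h1, map_smul_eq_mul, Real.norm_of_nonneg (by norm_num)]
    gcongr
    exact map_add_le_add p _ _
  calc gaussMean (p.comp (restrictCoord S))
      ≤ ∫ x, (1 / 2) * (q x + q (fun i => ε i * x i)) ∂_root_.stdGaussian n :=
        integral_mono (integrable_seminorm (comp_restrictCoord_sq_le hp S))
          ((hqi.add hqi').const_mul _) hle
    _ = gaussMean q := by
        rw [integral_const_mul, integral_add hqi hqi',
          integral_sign hε' q.continuous_of_finiteDimensional, gaussMean]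
        ring

/-- The first absolute moment of a standard Gaussian variable. -/
noncomputable def gaussAbsMoment : ℝ := ∫ x, |x| ∂gaussianReal 0 1

lemma integrable_abs_gaussianReal : Integrable (fun x => |x|) (gaussianReal 0 1) :=
  (((memLp_id_gaussianReal 1).integrable le_rfl).abs :)

lemma gaussAbsMoment_pos : 0 < gaussAbsMoment := by
  refine (integral_pos_iff_support_of_nonneg (fun x => abs_nonneg x)
    integrable_abs_gaussianReal).2 ?_
  have h : Function.support (fun x : ℝ => |x|) = {0}ᶜ := by ext x; simp
  have := nullSingletonClass_gaussianReal (μ := 0) (v := 1) one_ne_zero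
  rw [h, prob_compl_eq_one_sub (measurableSet_singleton _), measure_singleton]
  simp

lemma integrable_abs_eval (i : Fin n) :
    Integrable (fun x : Fin n → ℝ => |x i|) (_root_.stdGaussian n) :=
  (measurePreserving_eval (fun _ : Fin n => gaussianReal 0 1) i).integrable_comp_of_integrable
    integrable_abs_gaussianReal

lemma integral_abs_eval (i : Fin n) :
    ∫ x : Fin n → ℝ, |x i| ∂_root_.stdGaussian n = gaussAbsMoment := by
  rw [gaussAbsMoment]
  conv_rhs => rw [← (measurePreserving_eval (fun _ : Fin n => gaussianReal 0 1) i).map_eq]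
  rw [integral_map (measurable_pi_apply i).aemeasurable (by fun_prop)]
  rfl

lemma gaussMean_singleton_ge {p : Seminorm ℝ (Fin n → ℝ)} {j : Fin n}
    (hj : 1 / 2 ≤ p (Pi.single j 1)) :
    gaussAbsMoment / 2 ≤ gaussMean (p.comp (restrictCoord {j})) := by
  have h : ∀ x, p.comp (restrictCoord {j}) x = |x j| * p (Pi.single j 1) := by
    intro x
    have : restrictCoord {j} x = x j • Pi.single j (1 : ℝ) := by
      ext i
      rcases eq_or_ne i j with rfl | hi
      · simp [restrictCoord_apply]
      · simp [restrictCoord_apply, hi]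
    rw [Seminorm.comp_apply, this, map_smul_eq_mul, Real.norm_eq_abs]
  simp only [gaussMean, h]
  rw [integral_mul_const, integral_abs_eval]
  nlinarith [gaussAbsMoment_pos]

/-- Random signs are dominated by Gaussian coefficients. -/
lemma expect_sign_le_gaussMean {p : Seminorm ℝ (Fin n → ℝ)} (hp : ∀ x, p x ^ 2 ≤ ∑ i, x i ^ 2)
    {k : ℕ} {τ : Fin k → Fin n} (hτ : Function.Injective τ) :
    gaussAbsMoment * 𝔼 r : Fin k → Bool, p (∑ i, bitSign (r i) • Pi.single (τ i) 1) ≤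
      gaussMean (p.comp (restrictCoord (Finset.univ.image τ))) := by
  have hpc := p.continuous_of_finiteDimensional
  set S := Finset.univ.image τ with hS
  set q := p.comp (restrictCoord S) with hq
  have hqi := integrable_seminorm (comp_restrictCoord_sq_le hp S)
  set ε : (Fin k → Bool) → Fin n → ℝ := fun r => Function.extend τ (bitSign ∘ r) 1 with hε
  have hετ : ∀ r i, ε r (τ i) = bitSign (r i) := fun r i => by
    simp [hε, hτ.extend_apply]
  have hε' : ∀ r i, ε r i = 1 ∨ ε r i = -1 := by
    intro r i
    by_cases hi : ∃ a, τ a = i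
    · obtain ⟨a, rfl⟩ := hi; rw [hετ]; exact bitSign_eq _
    · left; simp [hε, Function.extend_apply' _ _ _ hi]
  have hmeas : ∀ r, MeasurePreserving (fun x i => ε r i * x i) (_root_.stdGaussian n)
      (_root_.stdGaussian n) := fun r => measurePreserving_sign (hε' r)
  have hpt : ∀ x : Fin n → ℝ, 𝔼 r, q (fun i => ε r i * x i) = 𝔼 r, q (fun i => ε r i * |x i|) := by
    intro x
    refine Fintype.expect_equiv (Equiv.piCongrRight fun i : Fin k =>
      if x (τ i) < 0 then Equiv.boolNot else Equiv.refl Bool) _ _ fun r => ?_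
    rw [hq, Seminorm.comp_apply, Seminorm.comp_apply]
    congr 1
    ext i
    simp only [restrictCoord_apply]
    split_ifs with hi
    · obtain ⟨a, -, rfl⟩ := Finset.mem_image.1 hi
      rw [hετ, hετ]
      by_cases hx : x (τ a) < 0
      · cases h : r a <;> simp [hx, abs_of_neg hx, bitSign, h]
      · simp [hx, abs_of_nonneg (not_lt.1 hx)]
    · rfl
  have hJ : ∀ r, gaussAbsMoment * p (∑ i, bitSign (r i) • Pi.single (τ i) 1) ≤
      ∫ x, q (fun i => ε r i * |x i|) ∂_root_.stdGaussian n := by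
    intro r
    have hvec : (∑ i, bitSign (r i) • Pi.single (τ i) 1 : Fin n → ℝ) = restrictCoord S (ε r) := by
      ext l
      simp only [Finset.sum_apply, Pi.smul_apply, smul_eq_mul, restrictCoord_apply]
      split_ifs with hl
      · obtain ⟨a, -, rfl⟩ := Finset.mem_image.1 hl
        rw [hετ, Finset.sum_eq_single a]
        · simp
        · intro b _ hb
          simp [(hτ.ne hb).symm]
        · simp
      · refine Finset.sum_eq_zero fun a _ => ?_
        have : l ≠ τ a := fun h => hl (h ▸ Finset.mem_image_of_mem _ (Finset.mem_univ _))
        simp [this]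
    rw [hvec]
    obtain ⟨u, hu, hux⟩ := exists_support_functional p (restrictCoord S (ε r))
    have hi : ∀ i ∈ S, Integrable (fun x : Fin n → ℝ => u i * (ε r i * |x i|))
        (_root_.stdGaussian n) := fun i _ => ((integrable_abs_eval i).const_mul _).const_mul _
    calc gaussAbsMoment * p (restrictCoord S (ε r))
        = ∫ x, ∑ i ∈ S, u i * (ε r i * |x i|) ∂_root_.stdGaussian n := by
          rw [integral_finsetSum _ hi, ← hux, sum_mul_restrictCoord, Finset.mul_sum]
          refine Finset.sum_congr rfl fun i _ => ?_
          rw [integral_const_mul, integral_const_mul, integral_abs_eval]; ring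
      _ ≤ _ := by
          refine integral_mono (integrable_finsetSum _ hi) ?_ fun x => ?_
          · refine integrable_stdGaussian ?_ fun x => ?_
            · have := q.continuous_of_finiteDimensional
              fun_prop
            · refine (abs_seminorm_le (comp_restrictCoord_sq_le hp S) _).trans (le_of_eq ?_)
              congr 1
              refine Finset.sum_congr rfl fun i _ => ?_
              rcases hε' r i with h | h <;> simp [h]
          · have h := hu (restrictCoord S fun i => ε r i * |x i|)
            rwa [sum_mul_restrictCoord] at h
  have hInteg : ∀ r, Integrable (fun x => q (fun i => ε r i * x i)) (_root_.stdGaussian n) :=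
    fun r => (hmeas r).integrable_comp_of_integrable hqi
  have hInteg' : ∀ r, Integrable (fun x => q (fun i => ε r i * |x i|)) (_root_.stdGaussian n) := by
    intro r
    refine integrable_stdGaussian ?_ fun x => ?_
    · have := q.continuous_of_finiteDimensional
      fun_prop
    · refine (abs_seminorm_le (comp_restrictCoord_sq_le hp S) _).trans (le_of_eq ?_)
      congr 1
      refine Finset.sum_congr rfl fun i _ => ?_
      rcases hε' r i with h | h <;> simp [h]
  have hswap : ∀ {f : (Fin k → Bool) → (Fin n → ℝ) → ℝ},
      (∀ r, Integrable (f r) (_root_.stdGaussian n)) →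
      ∫ x, 𝔼 r, f r x ∂_root_.stdGaussian n = 𝔼 r, ∫ x, f r x ∂_root_.stdGaussian n := by
    intro f hf
    simp only [Fintype.expect_eq_sum_div_card]
    rw [integral_div, integral_finsetSum _ fun r _ => hf r]
  rw [Finset.mul_expect]
  calc _ ≤ 𝔼 r, ∫ x, q (fun i => ε r i * |x i|) ∂_root_.stdGaussian n :=
        Finset.expect_le_expect fun r _ => hJ r
    _ = 𝔼 r, ∫ x, q (fun i => ε r i * x i) ∂_root_.stdGaussian n := by
        rw [← hswap hInteg', ← hswap hInteg]
        exact integral_congr_ae (ae_of_all _ fun x => (hpt x).symm)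
    _ = 𝔼 _r : Fin k → Bool, gaussMean q := by
        refine Finset.expect_congr rfl fun r _ => ?_
        rw [integral_sign (hε' r) q.continuous_of_finiteDimensional, gaussMean]
    _ = _ := Fintype.expect_const _

end Restriction

section Halving

open scoped BigOperators

lemma bitSign_not (b : Bool) : bitSign (!b) = -bitSign b := by cases b <;> simp [bitSign]

variable {B : Type} [Fintype B] [DecidableEq B]

/-- One step of the contraction principle: the absolute value of coordinate `j` is removed. -/
lemma exists_contraction_step (j : B) (T : Finset B) (hj : j ∉ T)
    (V : (B → Bool) → B → ℝ) :
    ∃ V' : (B → Bool) → B → ℝ, (∀ r, ∃ r', V' r = V r') ∧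
      𝔼 r, (∑ i ∈ T, bitSign (r i) * |V r i| + bitSign (r j) * |V r j| +
          ∑ i ∈ (insert j T)ᶜ, bitSign (r i) * V r i) ≤
        𝔼 r, (∑ i ∈ T, bitSign (r i) * |V' r i| + bitSign (r j) * V' r j +
          ∑ i ∈ (insert j T)ᶜ, bitSign (r i) * V' r i) := by
  classical
  set g : (B → Bool) → (B → ℝ) → ℝ := fun r v => ∑ i ∈ T, bitSign (r i) * |v i| +
    ∑ i ∈ (insert j T)ᶜ, bitSign (r i) * v i with hg
  have hgf : ∀ r v, g (flipBit j r) v = g r v := by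
    intro r v
    have hne : ∀ i, i ≠ j → flipBit j r i = r i := fun i hi => by simp [flipBit, hi]
    simp only [hg]
    congr 1 <;> refine Finset.sum_congr rfl fun i hi => ?_
    · rw [hne i fun h => hj (h ▸ hi)]
    · rw [hne i fun h => by simp [h] at hi]
  have hsj : ∀ r : B → Bool, bitSign (flipBit j r j) = -bitSign (r j) := fun r => by
    simp [flipBit, bitSign_not]
  have hff : ∀ r : B → Bool, flipBit j (flipBit j r) = r := fun r => (flipEquiv j).left_inv r
  set V' : (B → Bool) → B → ℝ := fun r =>
    if bitSign (r j) * (V r j - V (flipBit j r) j) < 0 then V (flipBit j r) else V r with hV'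
  refine ⟨V', fun r => ?_, ?_⟩
  · by_cases h : bitSign (r j) * (V r j - V (flipBit j r) j) < 0
    · exact ⟨flipBit j r, by simp [hV', h]⟩
    · exact ⟨r, by simp [hV', h]⟩
  have hsym : ∀ f : (B → Bool) → ℝ, 𝔼 r, f r = (1 / 2) * 𝔼 r, (f r + f (flipBit j r)) := by
    intro f
    rw [Finset.expect_add_distrib, expect_flipBit]; ring
  rw [hsym, hsym (fun r => _ + bitSign (r j) * V' r j + _)]
  refine mul_le_mul_of_nonneg_left (Finset.expect_le_expect fun r _ => ?_) (by norm_num)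
  have key : g r (V r) + bitSign (r j) * |V r j| +
      (g (flipBit j r) (V (flipBit j r)) + bitSign (flipBit j r j) * |V (flipBit j r) j|) ≤
      g r (V' r) + bitSign (r j) * V' r j +
      (g (flipBit j r) (V' (flipBit j r)) + bitSign (flipBit j r j) * V' (flipBit j r) j) := by
    rw [hgf, hgf, hsj]
    have hcond : bitSign (flipBit j r j) * (V (flipBit j r) j - V r j) =
        bitSign (r j) * (V r j - V (flipBit j r) j) := by rw [hsj]; ring
    have habs := abs_abs_sub_abs_le_abs_sub (V r j) (V (flipBit j r) j)
    rw [abs_le] at habs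
    simp only [hV', hcond, hff]
    rcases bitSign_eq (r j) with h | h <;> rw [h] <;> split_ifs with hlt
    · rw [abs_of_neg (by linarith)] at habs; linarith
    · rw [abs_of_nonneg (by linarith)] at habs; linarith
    · rw [abs_of_pos (by linarith)] at habs; linarith
    · rw [abs_of_nonpos (by linarith)] at habs; linarith
  simp only [hg] at key
  linarith

/-- The contraction principle for absolute values of the coordinates. -/
lemma expect_abs_contraction {K : Set (B → ℝ)} {P : (B → Bool) → ℝ}
    (hP : ∀ r, ∀ v ∈ K, ∑ i, bitSign (r i) * v i ≤ P r) {V : (B → Bool) → B → ℝ}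
    (hV : ∀ r, V r ∈ K) : 𝔼 r, ∑ i, bitSign (r i) * |V r i| ≤ 𝔼 r, P r := by
  have key : ∀ T : Finset B, ∀ V : (B → Bool) → B → ℝ, (∀ r, V r ∈ K) →
      𝔼 r, (∑ i ∈ T, bitSign (r i) * |V r i| + ∑ i ∈ Tᶜ, bitSign (r i) * V r i) ≤ 𝔼 r, P r := by
    intro T
    induction T using Finset.induction_on with
    | empty =>
      intro V hV
      exact Finset.expect_le_expect fun r _ => by simpa using hP r _ (hV r)
    | insert j T hj ih =>
      intro V hV
      obtain ⟨V', hV', hle⟩ := exists_contraction_step j T hj V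
      have h := ih V' fun r => by obtain ⟨r', hr'⟩ := hV' r; rw [hr']; exact hV r'
      have h1 : ∀ f : B → ℝ, ∑ i ∈ Tᶜ, f i = f j + ∑ i ∈ (insert j T)ᶜ, f i := by
        intro f
        rw [← Finset.sum_insert (s := (insert j T)ᶜ) (a := j) (by simp)]
        congr 1
        ext i
        rcases eq_or_ne i j with rfl | hi
        · simp [hj]
        · simp [hi]
      simp only [h1, ← add_assoc] at h
      refine le_trans (le_of_eq ?_) (hle.trans h)
      refine Finset.expect_congr rfl fun r _ => ?_
      rw [Finset.sum_insert hj]; ring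
  simpa using key Finset.univ V hV

/-- The sums over `S` of absolute values of functionals dominated by `p` are at most `w`. -/
def WidthLE {n : ℕ} (p : Seminorm ℝ (Fin n → ℝ)) (S : Finset (Fin n)) (w : ℝ) : Prop :=
  ∀ u : Fin n → ℝ, (∀ z, ∑ i, u i * z i ≤ p z) → ∑ j ∈ S, |u j| ≤ w

lemma expect_sum_abs_le {n k : ℕ} {p : Seminorm ℝ (Fin n → ℝ)}
    (hp : ∀ x, p x ^ 2 ≤ ∑ i, x i ^ 2) {τ : Fin k → Fin n} (hτ : Function.Injective τ) {L : ℝ}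
    (hL : gaussMean (p.comp (restrictCoord (Finset.univ.image τ))) ≤ L)
    {V : (Fin k → Bool) → Fin n → ℝ} (hV : ∀ r z, ∑ i, V r i * z i ≤ p z) :
    𝔼 r, ∑ i, bitSign (r i) * |V r (τ i)| ≤ L / gaussAbsMoment := by
  have h1 := expect_sign_le_gaussMean hp hτ
  rw [le_div_iff₀' gaussAbsMoment_pos]
  refine le_trans (mul_le_mul_of_nonneg_left ?_ gaussAbsMoment_pos.le) (h1.trans hL)
  refine expect_abs_contraction
    (K := {v | ∃ u : Fin n → ℝ, (∀ z, ∑ i, u i * z i ≤ p z) ∧ v = u ∘ τ}) ?_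
    (V := fun r => V r ∘ τ) fun r => ⟨V r, hV r, rfl⟩
  rintro r v ⟨u, hu, rfl⟩
  refine le_trans (le_of_eq ?_) (hu _)
  simp only [Finset.sum_apply, Finset.mul_sum]
  rw [Finset.sum_comm]
  refine Finset.sum_congr rfl fun i _ => ?_
  simp [Pi.single_apply, mul_comm]

lemma WidthLE.exists_half {n k : ℕ} {p : Seminorm ℝ (Fin n → ℝ)}
    (hp : ∀ x, p x ^ 2 ≤ ∑ i, x i ^ 2) {S : Finset (Fin n)} (hS : S.card = 2 * k) {L w : ℝ}
    (hL : gaussMean (p.comp (restrictCoord S)) ≤ L) (hw : WidthLE p S w) :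
    ∃ S' ⊆ S, S'.card = k ∧ WidthLE p S' (w / 2 + L / gaussAbsMoment) := by
  have e : S ≃ Fin k × Bool := Fintype.equivOfCardEq (by simp [hS, mul_comm])
  set σ : Fin k × Bool → Fin n := fun a => (e.symm a : Fin n) with hσ
  have hinj : Function.Injective σ := Subtype.val_injective.comp e.symm.injective
  have hmem : ∀ a, σ a ∈ S := fun a => (e.symm a).2
  have hinj1 : ∀ r : Fin k → Bool, Function.Injective fun i => σ (i, r i) := fun r i i' h =>
    congrArg Prod.fst (hinj h)
  have hsub : ∀ r : Fin k → Bool, (Finset.univ.image fun i => σ (i, r i)) ⊆ S := fun r =>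
    Finset.image_subset_iff.2 fun i _ => hmem _
  have hLb : ∀ r : Fin k → Bool, gaussMean (p.comp (restrictCoord
      (Finset.univ.image fun i => σ (i, r i)))) ≤ L := fun r =>
    (gaussMean_restrictCoord_mono hp (hsub r)).trans hL
  by_contra! hcon
  have hex : ∀ r : Fin k → Bool, ∃ u : Fin n → ℝ, (∀ z, ∑ i, u i * z i ≤ p z) ∧
      w / 2 + L / gaussAbsMoment < ∑ i, |u (σ (i, r i))| := by
    intro r
    have h := hcon _ (hsub r) (by rw [Finset.card_image_of_injective _ (hinj1 r)]; simp)
    unfold WidthLE at h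
    push Not at h
    obtain ⟨u, hu, hlt⟩ := h
    refine ⟨u, hu, ?_⟩
    rwa [Finset.sum_image fun a _ b _ hab => hinj1 r hab] at hlt
  choose V hV hVlt using hex
  have hlt : w / 2 + L / gaussAbsMoment < 𝔼 r, ∑ i, |V r (σ (i, r i))| := by
    rw [← Fintype.expect_const (ι := Fin k → Bool) (w / 2 + L / gaussAbsMoment)]
    exact Finset.expect_lt_expect (fun r _ => (hVlt r).le)
      ⟨fun _ => true, Finset.mem_univ _, hVlt _⟩
  have hpt : ∀ r : Fin k → Bool, ∑ i, |V r (σ (i, r i))| ≤ w / 2 +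
      (1 / 2) * (∑ i, bitSign (r i) * |V r (σ (i, true))|) +
      (1 / 2) * (∑ i, -bitSign (r i) * |V r (σ (i, false))|) := by
    intro r
    have h1 : ∑ i, (|V r (σ (i, true))| + |V r (σ (i, false))|) ≤ w := by
      refine le_of_eq_of_le ?_ (hw (V r) (hV r))
      rw [← Finset.sum_coe_sort S, ← e.symm.sum_comp, Fintype.sum_prod_type]
      simp [hσ]
    have h2 : ∑ i, |V r (σ (i, r i))| = (1 / 2) * ∑ i, (|V r (σ (i, true))| + |V r (σ (i, false))|)
        + (1 / 2) * (∑ i, bitSign (r i) * |V r (σ (i, true))|) +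
        (1 / 2) * (∑ i, -bitSign (r i) * |V r (σ (i, false))|) := by
      rw [Finset.mul_sum, Finset.mul_sum, Finset.mul_sum, ← Finset.sum_add_distrib,
        ← Finset.sum_add_distrib]
      refine Finset.sum_congr rfl fun i _ => ?_
      cases r i <;> simp [bitSign] <;> ring
    linarith
  have hA := expect_sum_abs_le hp (hinj1 fun _ => true) (hLb fun _ => true) hV
  have hB := expect_sum_abs_le hp (hinj1 fun _ => false) (hLb fun _ => false)
    (V := fun r => V fun i => !(r i)) fun r z => hV _ z
  have hB' : 𝔼 r : Fin k → Bool, ∑ i, bitSign (r i) * |V (fun i => !(r i)) (σ (i, false))| =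
      𝔼 r : Fin k → Bool, ∑ i, -bitSign (r i) * |V r (σ (i, false))| := by
    refine Fintype.expect_equiv (Equiv.piCongrRight fun _ : Fin k => Equiv.boolNot) _ _ fun r => ?_
    refine Finset.sum_congr rfl fun i _ => ?_
    simp only [Equiv.piCongrRight_apply, Pi.map_apply, Equiv.boolNot_apply, bitSign_not, neg_neg]
    rfl
  rw [hB'] at hB
  have hle := Finset.expect_le_expect fun r (_ : r ∈ Finset.univ) => hpt r
  rw [Finset.expect_add_distrib, Finset.expect_add_distrib, Fintype.expect_const,
    ← Finset.mul_expect, ← Finset.mul_expect] at hle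
  linarith

lemma WidthLE.of_card {n : ℕ} {p : Seminorm ℝ (Fin n → ℝ)}
    (hp : ∀ x, p x ^ 2 ≤ ∑ i, x i ^ 2) (S : Finset (Fin n)) : WidthLE p S (√S.card) := by
  intro u hu
  refine Real.le_sqrt_of_sq_le ?_
  refine sq_sum_le_card_mul_sum_sq.trans ?_
  refine mul_le_of_le_one_right (Nat.cast_nonneg _) ?_
  simp only [sq_abs]
  exact (Finset.sum_le_univ_sum_of_nonneg fun _ => sq_nonneg _).trans (sum_sq_support_le_one hp hu)

/-- Passing from `2 ^ a * m` coordinates to `m` coordinates with controlled width. -/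
lemma exists_subset_widthLE {n : ℕ} {p : Seminorm ℝ (Fin n → ℝ)}
    (hp : ∀ x, p x ^ 2 ≤ ∑ i, x i ^ 2) {L : ℝ} (m : ℕ) : ∀ (a : ℕ) (S : Finset (Fin n)) (w : ℝ),
      S.card = 2 ^ a * m → gaussMean (p.comp (restrictCoord S)) ≤ L → WidthLE p S w →
      ∃ S' ⊆ S, S'.card = m ∧ WidthLE p S' (w / 2 ^ a + 2 * (L / gaussAbsMoment) * (1 - 1 / 2 ^ a)) := by
  intro a
  induction a with
  | zero =>
    intro S w hS hL hw
    exact ⟨S, subset_rfl, by simpa using hS, by simpa using hw⟩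
  | succ a ih =>
    intro S w hS hL hw
    obtain ⟨S₁, hS₁, hc₁, hw₁⟩ := hw.exists_half hp (k := 2 ^ a * m) (by rw [hS]; ring) hL
    obtain ⟨S', hS', hc', hw'⟩ := ih S₁ _ hc₁ ((gaussMean_restrictCoord_mono hp hS₁).trans hL) hw₁
    refine ⟨S', hS'.trans hS₁, hc', ?_⟩
    convert hw' using 1
    rw [pow_succ]
    field_simp
    ring

end Halving

section Rotation

open scoped BigOperators

variable {n : ℕ}

instance : IsGaussian (_root_.stdGaussian n) := by
  rw [← isGaussian_map_equiv_iff (PiLp.continuousLinearEquiv 2 ℝ fun _ : Fin n => ℝ).symm]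
  have h : (_root_.stdGaussian n).map (PiLp.continuousLinearEquiv 2 ℝ fun _ : Fin n => ℝ).symm =
      ProbabilityTheory.stdGaussian (EuclideanSpace ℝ (Fin n)) := map_pi_eq_stdGaussian
  rw [h]
  infer_instance

lemma integral_id_stdGaussian : ∫ x, id x ∂_root_.stdGaussian n = 0 := by
  have h := (measurePreserving_sign (n := n) (ε := fun _ => -1) fun _ => Or.inr rfl)
  have h1 : ∫ x, id x ∂_root_.stdGaussian n = ∫ x, -id x ∂_root_.stdGaussian n := by
    conv_lhs => rw [← h.map_eq]
    rw [integral_map h.measurable.aemeasurable aestronglyMeasurable_id]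
    congr 1
    ext x i
    simp
  rw [integral_neg] at h1
  exact self_eq_neg.1 h1

lemma measurePreserving_rotation (θ : ℝ) :
    MeasurePreserving (ContinuousLinearMap.rotation (E := Fin n → ℝ) θ)
      ((_root_.stdGaussian n).prod (_root_.stdGaussian n))
      ((_root_.stdGaussian n).prod (_root_.stdGaussian n)) :=
  ⟨(ContinuousLinearMap.continuous _).measurable,
    IsGaussian.map_rotation_eq_self integral_id_stdGaussian θ⟩

lemma measurePreserving_cos_sin (θ : ℝ) :
    MeasurePreserving (fun z : (Fin n → ℝ) × (Fin n → ℝ) => cos θ • z.1 + sin θ • z.2)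
      ((_root_.stdGaussian n).prod (_root_.stdGaussian n)) (_root_.stdGaussian n) :=
  measurePreserving_fst.comp (measurePreserving_rotation θ)

lemma integrable_cos_sin {f : (Fin n → ℝ) → ℝ} (hf : Integrable f (_root_.stdGaussian n))
    (θ : ℝ) : Integrable (fun z : (Fin n → ℝ) × (Fin n → ℝ) => f (cos θ • z.1 + sin θ • z.2))
      ((_root_.stdGaussian n).prod (_root_.stdGaussian n)) :=
  (measurePreserving_cos_sin θ).integrable_comp_of_integrable hf

lemma integral_cos_sin {f : (Fin n → ℝ) → ℝ} (hf : Continuous f) (θ : ℝ) :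
    ∫ z : (Fin n → ℝ) × (Fin n → ℝ), f (cos θ • z.1 + sin θ • z.2)
      ∂((_root_.stdGaussian n).prod (_root_.stdGaussian n)) = ∫ x, f x ∂_root_.stdGaussian n := by
  conv_rhs => rw [← (measurePreserving_cos_sin θ).map_eq]
  rw [integral_map (measurePreserving_cos_sin θ).measurable.aemeasurable hf.aestronglyMeasurable]

lemma integral_rotation {f : (Fin n → ℝ) × (Fin n → ℝ) → ℝ} (hf : Continuous f) (θ : ℝ) :
    ∫ z, f (ContinuousLinearMap.rotation θ z)
      ∂((_root_.stdGaussian n).prod (_root_.stdGaussian n)) =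
    ∫ z, f z ∂((_root_.stdGaussian n).prod (_root_.stdGaussian n)) := by
  conv_rhs => rw [← (measurePreserving_rotation θ).map_eq]
  rw [integral_map (measurePreserving_rotation θ).measurable.aemeasurable hf.aestronglyMeasurable]

variable {q : Seminorm ℝ (Fin n → ℝ)}

lemma integrable_shift (hq : ∀ x, q x ^ 2 ≤ ∑ i, x i ^ 2) (S : Finset (Fin n)) (v : Fin n → ℝ) :
    Integrable (fun x => q (restrictCoord S x + v)) (_root_.stdGaussian n) := by
  have hc := q.continuous_of_finiteDimensional
  have hS : Continuous (restrictCoord S) := LinearMap.continuous_of_finiteDimensional _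
  refine ((integrable_seminorm (comp_restrictCoord_sq_le hq S)).add
    (integrable_const (q v))).mono' (by fun_prop) (ae_of_all _ fun x => ?_)
  rw [Real.norm_of_nonneg (apply_nonneg _ _)]
  exact map_add_le_add q _ _

/-- The increment of the odd function `q (y + v) - q (y - v)` along a rotation. -/
lemma integral_abs_increment_le (hq : ∀ x, q x ^ 2 ≤ ∑ i, x i ^ 2) (S : Finset (Fin n))
    (v : Fin n → ℝ) {ψ : (Fin n → ℝ) → ℝ}
    (hψ : ψ = fun x => q (restrictCoord S x + v) - q (restrictCoord S x + -v)) (α : ℝ) {δ : ℝ}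
    (hδ : 0 ≤ cos δ) :
    ∫ z : (Fin n → ℝ) × (Fin n → ℝ), |ψ (cos (α + δ) • z.1 + sin (α + δ) • z.2) -
        ψ (cos (α + -δ) • z.1 + sin (α + -δ) • z.2)|
        ∂((_root_.stdGaussian n).prod (_root_.stdGaussian n)) ≤
      2 * (∫ x, q (restrictCoord S x + v) ∂_root_.stdGaussian n) +
      2 * (∫ x, q (restrictCoord S x + -v) ∂_root_.stdGaussian n) -
      4 * cos δ * ∫ x, q (restrictCoord S x) ∂_root_.stdGaussian n := by
  have hc := q.continuous_of_finiteDimensional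
  have hS : Continuous (restrictCoord S) := LinearMap.continuous_of_finiteDimensional _
  set Y := restrictCoord S with hY
  have hψc : Continuous ψ := by rw [hψ]; fun_prop
  have hi1 := integrable_shift hq S v
  have hi2 := integrable_shift hq S (-v)
  have hi3 := integrable_seminorm (comp_restrictCoord_sq_le hq S)
  have hiψ : Integrable ψ (_root_.stdGaussian n) := by rw [hψ]; exact hi1.sub hi2
  have hrot : ∀ z : (Fin n → ℝ) × (Fin n → ℝ), |ψ (cos (α + δ) • z.1 + sin (α + δ) • z.2) -
        ψ (cos (α + -δ) • z.1 + sin (α + -δ) • z.2)| =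
      (fun w : (Fin n → ℝ) × (Fin n → ℝ) => |ψ (cos δ • w.1 + sin δ • w.2) -
        ψ (cos (-δ) • w.1 + sin (-δ) • w.2)|) (ContinuousLinearMap.rotation α z) := by
    intro z
    simp only [ContinuousLinearMap.rotation_apply, cos_add, sin_add, cos_neg, sin_neg]
    congr 3
    · module
    · module
  rw [integral_congr_ae (ae_of_all _ hrot), integral_rotation
    (f := fun w : (Fin n → ℝ) × (Fin n → ℝ) => |ψ (cos δ • w.1 + sin δ • w.2) -
      ψ (cos (-δ) • w.1 + sin (-δ) • w.2)|) (by fun_prop)]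
  have hle : ∀ w : (Fin n → ℝ) × (Fin n → ℝ), |ψ (cos δ • w.1 + sin δ • w.2) -
      ψ (cos (-δ) • w.1 + sin (-δ) • w.2)| ≤
      ((q (Y (cos δ • w.1 + sin δ • w.2) + v) + q (Y (cos (-δ) • w.1 + sin (-δ) • w.2) + v)) +
      (q (Y (cos δ • w.1 + sin δ • w.2) + -v) + q (Y (cos (-δ) • w.1 + sin (-δ) • w.2) + -v))) -
      4 * cos δ * q (Y w.1) := by
    intro w
    have h2 : q ((2 * cos δ) • Y w.1) = 2 * cos δ * q (Y w.1) := by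
      rw [map_smul_eq_mul, Real.norm_of_nonneg (by positivity)]
    have h3 : q ((2 * cos δ) • Y w.1) ≤ q (Y (cos δ • w.1 + sin δ • w.2) + v) +
        q (Y (cos (-δ) • w.1 + sin (-δ) • w.2) + -v) := by
      refine le_trans (le_of_eq ?_) (map_add_le_add q _ _)
      simp only [cos_neg, sin_neg, map_add, map_smul]
      congr 1
      module
    have h4 : q ((2 * cos δ) • Y w.1) ≤ q (Y (cos δ • w.1 + sin δ • w.2) + -v) +
        q (Y (cos (-δ) • w.1 + sin (-δ) • w.2) + v) := by
      refine le_trans (le_of_eq ?_) (map_add_le_add q _ _)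
      simp only [cos_neg, sin_neg, map_add, map_smul]
      congr 1
      module
    rw [hψ, abs_le]
    constructor <;> simp only <;> linarith
  have hfst : Integrable (fun w : (Fin n → ℝ) × (Fin n → ℝ) => q (Y w.1))
      ((_root_.stdGaussian n).prod (_root_.stdGaussian n)) :=
    measurePreserving_fst.integrable_comp_of_integrable hi3
  have hfst' : ∫ w : (Fin n → ℝ) × (Fin n → ℝ), q (Y w.1)
      ∂((_root_.stdGaussian n).prod (_root_.stdGaussian n)) =
      ∫ x, q (Y x) ∂_root_.stdGaussian n := by
    simpa using integral_cos_sin (f := fun x => q (Y x)) (by fun_prop) 0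
  have i1 := integrable_cos_sin hi1 δ
  have i2 := integrable_cos_sin hi1 (-δ)
  have i3 := integrable_cos_sin hi2 δ
  have i4 := integrable_cos_sin hi2 (-δ)
  refine (integral_mono (((integrable_cos_sin hiψ δ).sub (integrable_cos_sin hiψ (-δ))).abs)
    (((i1.add i2).add (i3.add i4)).sub (hfst.const_mul _)) hle).trans (le_of_eq ?_)
  rw [integral_sub' ((i1.add i2).add (i3.add i4)) (hfst.const_mul _),
    integral_add' (i1.add i2) (i3.add i4), integral_add' i1 i2, integral_add' i3 i4,
    integral_const_mul, hfst', integral_cos_sin (f := fun x => q (Y x + v)) (by fun_prop),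
    integral_cos_sin (f := fun x => q (Y x + v)) (by fun_prop),
    integral_cos_sin (f := fun x => q (Y x + -v)) (by fun_prop),
    integral_cos_sin (f := fun x => q (Y x + -v)) (by fun_prop)]
  ring

/-- The odd part of `q (y + v)` is controlled by the second difference of `q`. -/
lemma integral_abs_odd_part_le (hq : ∀ x, q x ^ 2 ≤ ∑ i, x i ^ 2) (S : Finset (Fin n))
    (v : Fin n → ℝ) {N : ℕ} (hN : 0 < N) :
    ∫ x, |q (restrictCoord S x + v) - q (restrictCoord S x + -v)| ∂_root_.stdGaussian n ≤
      N * ((∫ x, q (restrictCoord S x + v) ∂_root_.stdGaussian n) +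
      (∫ x, q (restrictCoord S x + -v) ∂_root_.stdGaussian n) -
      2 * cos (π / (2 * N)) * ∫ x, q (restrictCoord S x) ∂_root_.stdGaussian n) := by
  have hc := q.continuous_of_finiteDimensional
  have hS : Continuous (restrictCoord S) := LinearMap.continuous_of_finiteDimensional _
  have hN' : (0 : ℝ) < N := Nat.cast_pos.2 hN
  set ψ : (Fin n → ℝ) → ℝ := fun x => q (restrictCoord S x + v) - q (restrictCoord S x + -v)
    with hψ
  have hψc : Continuous ψ := by rw [hψ]; fun_prop
  have hiψ : Integrable ψ (_root_.stdGaussian n) := by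
    rw [hψ]; exact (integrable_shift hq S v).sub (integrable_shift hq S (-v))
  set δ : ℝ := π / (2 * N) with hδ
  have hcos : 0 ≤ cos δ := by
    refine cos_nonneg_of_neg_pi_div_two_le_of_le ?_ ?_
    · have : 0 ≤ δ := by positivity
      linarith [pi_pos]
    · rw [hδ]
      have : (1 : ℝ) ≤ N := by exact_mod_cast hN
      gcongr
      linarith
  have hodd : ∀ x, ψ (-x) = -ψ x := by
    intro x
    simp only [hψ, map_neg]
    rw [← map_neg_eq_map q (-(restrictCoord S x) + v), ← map_neg_eq_map q (-(restrictCoord S x) + -v),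
      show -(-(restrictCoord S x) + v) = restrictCoord S x + -v by abel,
      show -(-(restrictCoord S x) + -v) = restrictCoord S x + v by abel]
    ring
  set Z : ℕ → (Fin n → ℝ) × (Fin n → ℝ) → Fin n → ℝ := fun k z =>
    cos (2 * k * δ) • z.1 + sin (2 * k * δ) • z.2 with hZ
  have hZ0 : ∀ z, Z 0 z = z.1 := fun z => by simp [hZ]
  have hZN : ∀ z, Z N z = -z.1 := fun z => by
    have : 2 * (N : ℝ) * δ = π := by rw [hδ]; field_simp
    simp only [hZ, this]; simp
  have hpt : ∀ z, 2 * |ψ z.1| ≤ ∑ k ∈ Finset.range N, |ψ (Z (k + 1) z) - ψ (Z k z)| := by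
    intro z
    have h1 := Finset.abs_sum_le_sum_abs (fun k => ψ (Z (k + 1) z) - ψ (Z k z)) (Finset.range N)
    rw [Finset.sum_range_sub (fun k => ψ (Z k z)), hZ0, hZN, hodd,
      show -ψ z.1 - ψ z.1 = -(2 * ψ z.1) by ring, abs_neg, abs_mul, abs_two] at h1
    exact h1
  have hiZ : ∀ k, Integrable (fun z => |ψ (Z (k + 1) z) - ψ (Z k z)|)
      ((_root_.stdGaussian n).prod (_root_.stdGaussian n)) := fun k =>
    ((integrable_cos_sin hiψ _).sub (integrable_cos_sin hiψ _)).abs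
  have hstep : ∀ k : ℕ, ∫ z, |ψ (Z (k + 1) z) - ψ (Z k z)|
      ∂((_root_.stdGaussian n).prod (_root_.stdGaussian n)) ≤
      2 * (∫ x, q (restrictCoord S x + v) ∂_root_.stdGaussian n) +
      2 * (∫ x, q (restrictCoord S x + -v) ∂_root_.stdGaussian n) -
      4 * cos δ * ∫ x, q (restrictCoord S x) ∂_root_.stdGaussian n := by
    intro k
    refine le_of_eq_of_le ?_ (integral_abs_increment_le hq S v hψ ((2 * k + 1) * δ) hcos)
    simp only [hZ]
    rw [show 2 * ((k + 1 : ℕ) : ℝ) * δ = (2 * k + 1) * δ + δ by push_cast; ring,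
      show 2 * (k : ℝ) * δ = (2 * k + 1) * δ + -δ by ring]
  have hfst : ∫ z : (Fin n → ℝ) × (Fin n → ℝ), 2 * |ψ z.1|
      ∂((_root_.stdGaussian n).prod (_root_.stdGaussian n)) =
      2 * ∫ x, |ψ x| ∂_root_.stdGaussian n := by
    rw [integral_const_mul]
    congr 1
    simpa using integral_cos_sin (f := fun x => |ψ x|) (by fun_prop) 0
  have hle : 2 * ∫ x, |ψ x| ∂_root_.stdGaussian n ≤ ∑ k ∈ Finset.range N,
      ∫ z, |ψ (Z (k + 1) z) - ψ (Z k z)|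
      ∂((_root_.stdGaussian n).prod (_root_.stdGaussian n)) := by
    rw [← hfst, ← integral_finsetSum _ fun k _ => hiZ k]
    refine integral_mono ?_ (integrable_finsetSum _ fun k _ => hiZ k) hpt
    exact (measurePreserving_fst.integrable_comp_of_integrable hiψ.abs).const_mul 2
  have h := hle.trans (Finset.sum_le_sum fun k _ => hstep k)
  rw [Finset.sum_const, Finset.card_range, nsmul_eq_mul] at h
  linarith

end Rotation

section Influence

open scoped BigOperators

variable {n : ℕ}

lemma measurePreserving_update (j : Fin n) :
    MeasurePreserving (fun z : (Fin n → ℝ) × ℝ => Function.update z.1 j z.2)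
      ((_root_.stdGaussian n).prod (gaussianReal 0 1)) (_root_.stdGaussian n) := by
  have hm : Measurable (fun z : (Fin n → ℝ) × ℝ => Function.update z.1 j z.2) := by
    refine measurable_pi_lambda _ fun i => ?_
    rcases eq_or_ne i j with rfl | h
    · simpa using measurable_snd
    · simp only [Function.update_of_ne h]
      exact (measurable_pi_apply i).comp measurable_fst
  refine ⟨hm, (Measure.pi_eq fun s hs => ?_).symm⟩
  have hpre : (fun z : (Fin n → ℝ) × ℝ => Function.update z.1 j z.2) ⁻¹' Set.univ.pi s =
      (Set.univ.pi (Function.update s j Set.univ)) ×ˢ s j := by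
    ext z
    simp only [Set.mem_preimage, Set.mem_pi, Set.mem_univ, true_imp_iff, Set.mem_prod]
    constructor
    · intro h
      refine ⟨fun i => ?_, by simpa using h j⟩
      rcases eq_or_ne i j with rfl | hi
      · simp
      · simpa [hi] using h i
    · rintro ⟨h1, h2⟩ i
      rcases eq_or_ne i j with rfl | hi
      · simpa using h2
      · simpa [hi] using h1 i
  rw [Measure.map_apply hm (MeasurableSet.univ_pi hs), hpre, Measure.prod_prod,
    _root_.stdGaussian, Measure.pi_pi, ← Finset.prod_erase_mul _ _ (Finset.mem_univ j),
    ← Finset.prod_erase_mul (Finset.univ) (fun i => gaussianReal 0 1 (s i)) (Finset.mem_univ j)]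
  simp only [Function.update_self, measure_univ, mul_one]
  congr 1
  refine Finset.prod_congr rfl fun i hi => ?_
  rw [Function.update_of_ne (Finset.ne_of_mem_erase hi)]

variable {q : Seminorm ℝ (Fin n → ℝ)}

lemma update_eq_restrictCoord_add (x : Fin n → ℝ) (j : Fin n) (g : ℝ) :
    Function.update x j g = restrictCoord (Finset.univ.erase j) x + g • Pi.single j 1 := by
  ext i
  rcases eq_or_ne i j with rfl | h
  · simp [restrictCoord_apply]
  · simp [restrictCoord_apply, h]

lemma one_sub_cos_le (N : ℕ) (hN : 0 < N) : 1 - cos (π / (2 * N)) ≤ 1.25 / N ^ 2 := by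
  have h := one_sub_sq_div_two_le_cos (x := π / (2 * N))
  have hN' : (0 : ℝ) < N := Nat.cast_pos.2 hN
  have h2 : (π / (2 * N)) ^ 2 / 2 ≤ 1.25 / N ^ 2 := by
    have : (π / (2 * N)) ^ 2 / 2 = (π ^ 2 / 8) / N ^ 2 := by field_simp; ring
    rw [this]
    gcongr
    nlinarith [pi_lt_d2, pi_pos]
  linarith

/-- The mean effect of reflecting one coordinate. -/
lemma integral_abs_reflect_le (hq : ∀ x, q x ^ 2 ≤ ∑ i, x i ^ 2) (j : Fin n) {N : ℕ}
    (hN : 0 < N) :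
    ∫ x, |q x - q (Function.update x j (-x j))| ∂_root_.stdGaussian n ≤
      2 * N * ((∫ x, q x ∂_root_.stdGaussian n) -
      cos (π / (2 * N)) * ∫ x, q (Function.update x j 0) ∂_root_.stdGaussian n) := by
  have hc := q.continuous_of_finiteDimensional
  have hcf : Continuous fun x => |q x - q (Function.update x j (-x j))| := by fun_prop
  have hmp := measurePreserving_update j
  set S := (Finset.univ : Finset (Fin n)).erase j with hS
  set e : Fin n → ℝ := Pi.single j 1 with he
  have hsq : ∀ x : Fin n → ℝ, ∑ i, Function.update x j (-x j) i ^ 2 = ∑ i, x i ^ 2 := by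
    intro x
    refine Finset.sum_congr rfl fun i _ => ?_
    rcases eq_or_ne i j with rfl | h <;> simp [*]
  have hiq := integrable_seminorm hq
  have hiq' : Integrable (fun x => q (Function.update x j (-x j))) (_root_.stdGaussian n) :=
    integrable_stdGaussian (by fun_prop) fun x => by
      rw [← hsq]; exact abs_seminorm_le hq _
  have hif : Integrable (fun x => |q x - q (Function.update x j (-x j))|)
    (_root_.stdGaussian n) := (hiq.sub hiq').abs
  have hi1 := hmp.integrable_comp_of_integrable hif
  have hi2 := hmp.integrable_comp_of_integrable hiq
  have hi3 := hmp.integrable_comp_of_integrable hiq'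
  have hswap : ∀ {f : (Fin n → ℝ) → ℝ}, Continuous f → Integrable f (_root_.stdGaussian n) →
      ∫ g, ∫ x, f (restrictCoord S x + g • e) ∂_root_.stdGaussian n ∂gaussianReal 0 1 =
      ∫ x, f x ∂_root_.stdGaussian n := by
    intro f hf hfi
    rw [← integral_prod_symm (fun z : (Fin n → ℝ) × ℝ => f (restrictCoord S z.1 + z.2 • e))]
    · conv_rhs => rw [← hmp.map_eq]
      rw [integral_map hmp.measurable.aemeasurable hf.aestronglyMeasurable]
      simp only [update_eq_restrictCoord_add, hS, he]
    · have := hmp.integrable_comp_of_integrable hfi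
      simpa only [Function.comp_def, update_eq_restrictCoord_add] using this
  have hright : ∀ {f : (Fin n → ℝ) → ℝ}, Integrable f (_root_.stdGaussian n) →
      Integrable (fun g => ∫ x, f (restrictCoord S x + g • e) ∂_root_.stdGaussian n)
        (gaussianReal 0 1) := by
    intro f hfi
    have := (hmp.integrable_comp_of_integrable hfi).integral_prod_right
    simpa only [Function.comp_def, update_eq_restrictCoord_add] using this
  have hrefl : ∀ x (g : ℝ), Function.update (restrictCoord S x + g • e) j
      (-(restrictCoord S x j + (g • e) j)) = restrictCoord S x + -(g • e) := by
    intro x g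
    rw [← Pi.add_apply, ← update_eq_restrictCoord_add, Function.update_idem, Function.update_self,
      update_eq_restrictCoord_add, neg_smul]
  have hsign : ∫ x, q (Function.update x j (-x j)) ∂_root_.stdGaussian n =
      ∫ x, q x ∂_root_.stdGaussian n := by
    rw [← integral_sign (ε := fun i => if i = j then -1 else 1)
      (fun i => by by_cases h : i = j <;> simp [h]) hc]
    congr 1
    ext x
    congr 1
    ext i
    rcases eq_or_ne i j with rfl | h <;> simp [*]
  have hzero : ∀ x, q (Function.update x j 0) = q (restrictCoord S x) := fun x => by
    rw [update_eq_restrictCoord_add]; simp [hS]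
  have h1 := integral_mono (hright hif) (((hright hiq).add (hright hiq')).sub
    (integrable_const (2 * cos (π / (2 * N)) *
      ∫ x, q (restrictCoord S x) ∂_root_.stdGaussian n)) |>.const_mul (N : ℝ)) (fun g => by
        have := integral_abs_odd_part_le hq S (g • e) hN
        simp only [Pi.sub_apply, Pi.add_apply, hrefl]
        exact this)
  rw [hswap hcf hif, integral_const_mul, integral_sub' ((hright hiq).add (hright hiq'))
    (integrable_const _), integral_add' (hright hiq) (hright hiq'), hswap hc hiq,
    hswap (f := fun x => q (Function.update x j (-x j))) (by fun_prop) hiq', hsign] at h1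
  simp only [hzero]
  simp at h1
  linarith

/-- The `L¹` influence of a coordinate in terms of the loss of Gaussian mean. -/
lemma integral_abs_update_le (hq : ∀ x, q x ^ 2 ≤ ∑ i, x i ^ 2) (j : Fin n) {N : ℕ}
    (hN : 0 < N) :
    ∫ x, |q x - q (Function.update x j 0)| ∂_root_.stdGaussian n ≤
      (2 * N + 1) * (gaussMean q - ∫ x, q (Function.update x j 0) ∂_root_.stdGaussian n) +
      2.5 / N * ∫ x, q (Function.update x j 0) ∂_root_.stdGaussian n := by
  have hc := q.continuous_of_finiteDimensional
  have hiq := integrable_seminorm hq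
  have hsq : ∀ x : Fin n → ℝ, ∑ i, Function.update x j (-x j) i ^ 2 = ∑ i, x i ^ 2 := by
    intro x
    refine Finset.sum_congr rfl fun i _ => ?_
    rcases eq_or_ne i j with rfl | h <;> simp [*]
  have hiq' : Integrable (fun x => q (Function.update x j (-x j))) (_root_.stdGaussian n) :=
    integrable_stdGaussian (by fun_prop) fun x => by
      rw [← hsq]; exact abs_seminorm_le hq _
  have hi0 : Integrable (fun x => q (Function.update x j 0)) (_root_.stdGaussian n) :=
    integrable_stdGaussian (by fun_prop) fun x =>
      (abs_seminorm_le hq _).trans (by linarith [sum_sq_update_zero_le x j])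
  have hpt : ∀ x, |q x - q (Function.update x j 0)| ≤
      (q x - q (Function.update x j 0)) + |q x - q (Function.update x j (-x j))| := by
    intro x
    have h1 : q ((2 : ℝ) • Function.update x j 0) ≤ q x + q (Function.update x j (-x j)) := by
      refine le_trans (le_of_eq ?_) (map_add_le_add q _ _)
      congr 1
      ext i
      rcases eq_or_ne i j with rfl | h
      · simp
      · simp [h]; ring
    rw [map_smul_eq_mul, Real.norm_of_nonneg (by norm_num)] at h1
    have h2 := le_abs_self (q x - q (Function.update x j (-x j)))
    have h3 := neg_abs_le (q x - q (Function.update x j (-x j)))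
    rw [abs_le]
    constructor <;> linarith [abs_nonneg (q x - q (Function.update x j (-x j)))]
  have h1 := integral_mono (hiq.sub hi0).abs ((hiq.sub hi0).add (hiq.sub hiq').abs) hpt
  rw [integral_add' (hiq.sub hi0) (hiq.sub hiq').abs, integral_sub' hiq hi0] at h1
  have h2 := integral_abs_reflect_le hq j hN
  have h3 := one_sub_cos_le N hN
  have hN' : (0 : ℝ) < N := Nat.cast_pos.2 hN
  have h4 : 0 ≤ ∫ x, q (Function.update x j 0) ∂_root_.stdGaussian n :=
    integral_nonneg fun _ => apply_nonneg _ _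
  set F₀ := ∫ x, q (Function.update x j 0) ∂_root_.stdGaussian n
  have h5 : 2 * N * ((1 - cos (π / (2 * N))) * F₀) ≤ 2.5 / N * F₀ := by
    calc 2 * N * ((1 - cos (π / (2 * N))) * F₀) ≤ 2 * N * ((1.25 / N ^ 2) * F₀) := by gcongr
      _ = 2.5 / N * F₀ := by field_simp; ring
  rw [gaussMean]
  simp only [Pi.sub_apply] at h1
  linarith

end Influence

section InfluenceSum

open scoped BigOperators

variable {n : ℕ}

lemma integrable_exp_abs_gaussianReal : Integrable (fun x => exp |x|) (gaussianReal 0 1) := by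
  have h1 := integrable_exp_mul_gaussianReal (μ := 0) (v := 1) 1
  have h2 := integrable_exp_mul_gaussianReal (μ := 0) (v := 1) (-1)
  refine (h1.add h2).mono' (by fun_prop) (ae_of_all _ fun x => ?_)
  rw [Real.norm_of_nonneg (exp_pos _).le]
  simp only [Pi.add_apply, one_mul, neg_mul]
  exact exp_abs_le x

lemma integral_exp_abs_gaussianReal_le : ∫ x, exp |x| ∂gaussianReal 0 1 ≤ 4 := by
  have h1 := integrable_exp_mul_gaussianReal (μ := 0) (v := 1) 1
  have h2 := integrable_exp_mul_gaussianReal (μ := 0) (v := 1) (-1)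
  have e1 := mgf_gaussian_le 1 (by norm_num)
  have e2 := mgf_gaussian_le (-1) (by norm_num)
  simp only [mgf, id] at e1 e2
  have h := integral_mono integrable_exp_abs_gaussianReal (h1.add h2) fun x => by
    simp only [Pi.add_apply, one_mul, neg_mul]
    exact exp_abs_le x
  rw [integral_add' h1 h2] at h
  have h3 : exp (1 / 2) ≤ 2 := by
    have h4 : exp (1 / 2) ^ 2 ≤ 2 ^ 2 := by
      rw [← exp_nat_mul]
      norm_num
      linarith [exp_one_lt_d9]
    exact le_of_sq_le_sq h4 (by norm_num)
  linarith

lemma integrable_exp_abs_eval (i : Fin n) (B : ℝ) :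
    Integrable (fun x : Fin n → ℝ => exp (|x i| - B)) (_root_.stdGaussian n) := by
  simp only [exp_sub]
  exact ((measurePreserving_eval (fun _ : Fin n => gaussianReal 0 1)
    i).integrable_comp_of_integrable integrable_exp_abs_gaussianReal).div_const _

lemma integral_exp_abs_eval_le (i : Fin n) (B : ℝ) :
    ∫ x : Fin n → ℝ, exp (|x i| - B) ∂_root_.stdGaussian n ≤ 4 / exp B := by
  simp only [exp_sub, integral_div]
  gcongr
  refine le_trans (le_of_eq ?_) integral_exp_abs_gaussianReal_le
  conv_rhs => rw [← (measurePreserving_eval (fun _ : Fin n => gaussianReal 0 1) i).map_eq]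
  rw [integral_map (measurable_pi_apply i).aemeasurable (by fun_prop)]
  rfl

/-- The total `L¹` influence is controlled by the width. -/
lemma sum_influence_le {p : Seminorm ℝ (Fin n → ℝ)} (hp : ∀ x, p x ^ 2 ≤ ∑ i, x i ^ 2)
    {I : Finset (Fin n)} {W : ℝ} (hW : WidthLE p I W) {m : ℕ} (hm : 0 < m) (hI : I.card ≤ m)
    {q : Seminorm ℝ (Fin n → ℝ)} (hq : q = p.comp (restrictCoord I)) :
    ∑ j, ∫ x, |q x - q (Function.update x j 0)| ∂_root_.stdGaussian n ≤
      2 * (W * (log m + 4)) := by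
  have hq2 : ∀ x, q x ^ 2 ≤ ∑ i, x i ^ 2 := by rw [hq]; exact comp_restrictCoord_sq_le hp I
  have hc := q.continuous_of_finiteDimensional
  have hiq := integrable_seminorm hq2
  have hi0 : ∀ j, Integrable (fun x => q (Function.update x j 0)) (_root_.stdGaussian n) :=
    fun j => integrable_stdGaussian (by fun_prop) fun x =>
      (abs_seminorm_le hq2 _).trans (by linarith [sum_sq_update_zero_le x j])
  have hupd : ∀ x j, q (Function.update x j 0) = p.comp (restrictCoord (I.erase j)) x := by
    intro x j
    rw [hq, Seminorm.comp_apply, restrictCoord_update, Seminorm.comp_apply]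
  set D : Fin n → (Fin n → ℝ) → ℝ := fun j x => q x - q (Function.update x j 0) with hD
  have hDi : ∀ j, Integrable (D j) (_root_.stdGaussian n) := fun j => hiq.sub (hi0 j)
  have hDnn : ∀ j, 0 ≤ ∫ x, D j x ∂_root_.stdGaussian n := by
    intro j
    simp only [hD]
    rw [integral_sub hiq (hi0 j)]
    simp only [hupd]
    have := gaussMean_restrictCoord_mono hp (Finset.erase_subset j I)
    rw [← hq] at this
    simp only [gaussMean] at this
    linarith
  have hW0 : 0 ≤ W := by
    obtain ⟨u, hu, -⟩ := exists_support_functional p 0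
    exact (Finset.sum_nonneg fun j _ => abs_nonneg _).trans (hW u hu)
  set E : (Fin n → ℝ) → ℝ := fun x => log m + ∑ i ∈ I, exp (|x i| - log m) with hE
  have hEi : Integrable E (_root_.stdGaussian n) :=
    (integrable_const _).add (integrable_finsetSum _ fun i _ => integrable_exp_abs_eval i _)
  have hlogm : 0 ≤ log m := log_natCast_nonneg m
  have hpt : ∀ x, ∑ j, max (D j x) 0 ≤ W * E x := by
    intro x
    obtain ⟨u, hu, hux⟩ := exists_support_functional p (restrictCoord I x)
    rw [sum_mul_restrictCoord] at hux
    have hE0 : 0 ≤ E x := add_nonneg hlogm (Finset.sum_nonneg fun _ _ => (exp_pos _).le)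
    have hxj : ∀ j ∈ I, |x j| ≤ E x := by
      intro j hj
      have h1 : exp (|x j| - log m) ≤ ∑ i ∈ I, exp (|x i| - log m) :=
        Finset.single_le_sum (f := fun i => exp (|x i| - log m)) (fun _ _ => (exp_pos _).le) hj
      have h2 := add_one_le_exp (|x j| - log m)
      simp only [hE]
      linarith
    have hDj : ∀ j, max (D j x) 0 ≤ if j ∈ I then |u j| * E x else 0 := by
      intro j
      split_ifs with hj
      · refine max_le ?_ (by positivity)
        have h1 := hu (restrictCoord (I.erase j) x)
        rw [sum_mul_restrictCoord] at h1
        rw [← Finset.sum_erase_add _ _ hj] at hux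
        have h2 : D j x ≤ u j * x j := by
          simp only [hD]
          rw [hupd, Seminorm.comp_apply, hq, Seminorm.comp_apply]
          linarith
        calc D j x ≤ u j * x j := h2
          _ ≤ |u j| * |x j| := by rw [← abs_mul]; exact le_abs_self _
          _ ≤ _ := by gcongr; exact hxj j hj
      · refine max_le ?_ le_rfl
        simp only [hD]
        rw [hupd, Finset.erase_eq_of_notMem hj, ← hq, sub_self]
    calc ∑ j, max (D j x) 0 ≤ ∑ j, if j ∈ I then |u j| * E x else 0 :=
          Finset.sum_le_sum fun j _ => hDj j
      _ = (∑ j ∈ I, |u j|) * E x := by simp [Finset.sum_mul]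
      _ ≤ _ := by gcongr; exact hW u hu
  have habs : ∀ j, ∫ x, |D j x| ∂_root_.stdGaussian n ≤
      2 * ∫ x, max (D j x) 0 ∂_root_.stdGaussian n := by
    intro j
    have hmax : Integrable (fun x => max (D j x) 0) (_root_.stdGaussian n) := (hDi j).pos_part
    have : ∀ x, |D j x| = 2 * max (D j x) 0 - D j x := fun x => by
      rcases le_total 0 (D j x) with h | h
      · rw [abs_of_nonneg h, max_eq_left h]; ring
      · rw [abs_of_nonpos h, max_eq_right h]; ring
    simp only [this]
    rw [integral_sub (hmax.const_mul 2) (hDi j), integral_const_mul]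
    linarith [hDnn j]
  have hEint : ∫ x, E x ∂_root_.stdGaussian n ≤ log m + 4 := by
    simp only [hE]
    rw [integral_add (integrable_const _)
      (integrable_finsetSum _ fun i _ => integrable_exp_abs_eval i _),
      integral_finsetSum _ fun i _ => integrable_exp_abs_eval i _]
    have hm' : (0 : ℝ) < m := Nat.cast_pos.2 hm
    have : ∑ i ∈ I, ∫ x : Fin n → ℝ, exp (|x i| - log m) ∂_root_.stdGaussian n ≤ 4 := by
      calc _ ≤ ∑ _i ∈ I, 4 / exp (log m) :=
            Finset.sum_le_sum fun i _ => integral_exp_abs_eval_le i _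
        _ = I.card * (4 / m) := by rw [exp_log hm', Finset.sum_const, nsmul_eq_mul]
        _ ≤ m * (4 / m) := by gcongr
        _ = 4 := by field_simp
    simp
    linarith
  calc _ ≤ ∑ j, 2 * ∫ x, max (D j x) 0 ∂_root_.stdGaussian n :=
        Finset.sum_le_sum fun j _ => habs j
    _ = 2 * ∫ x, ∑ j, max (D j x) 0 ∂_root_.stdGaussian n := by
        rw [integral_finsetSum _ fun j _ => (hDi j).pos_part, Finset.mul_sum]
    _ ≤ 2 * ∫ x, W * E x ∂_root_.stdGaussian n := by
        refine mul_le_mul_of_nonneg_left ?_ zero_le_two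
        exact integral_mono (integrable_finsetSum _ fun j _ => (hDi j).pos_part)
          (hEi.const_mul W) hpt
    _ ≤ _ := by
        rw [integral_const_mul]
        gcongr

end InfluenceSum

section LowerBound

open scoped BigOperators

variable {n : ℕ}

lemma gaussianReal_tail_ge {t : ℝ} (ht : 0 ≤ t) :
    exp (-(t + 1) ^ 2 / 2) / 3 ≤ (gaussianReal 0 1).real {y | t < |y|} := by
  have hsub : Set.Ioc t (t + 1) ⊆ {y : ℝ | t < |y|} := fun y hy => hy.1.trans_le (le_abs_self y)
  refine le_trans ?_ (measureReal_mono hsub)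
  have hpi : √(2 * π) ≤ 3 := by
    rw [Real.sqrt_le_left (by norm_num)]
    nlinarith [pi_lt_d2]
  have hpi0 : 0 < √(2 * π) := by positivity
  rw [measureReal_def, gaussianReal_apply_eq_integral 0 one_ne_zero,
    ENNReal.toReal_ofReal (integral_nonneg fun y => gaussianPDFReal_nonneg _ _ _)]
  have hInteg : IntegrableOn (gaussianPDFReal 0 1) (Set.Ioc t (t + 1)) :=
    (integrable_gaussianPDFReal 0 1).integrableOn
  have h := setIntegral_mono_on (μ := volume) (s := Set.Ioc t (t + 1))
    (f := fun _ => exp (-(t + 1) ^ 2 / 2) / 3)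
    (integrableOn_const (by simp)) hInteg measurableSet_Ioc (fun y hy => by
      rw [gaussianPDFReal, div_eq_inv_mul]
      simp only [sub_zero, NNReal.coe_one, mul_one]
      have h1 : -(t + 1) ^ 2 / 2 ≤ -y ^ 2 / 2 := by nlinarith [hy.1, hy.2]
      gcongr)
  refine le_trans (le_of_eq ?_) h
  rw [setIntegral_const]
  simp

lemma measureReal_exists_gt_ge (I : Finset (Fin n)) (t : ℝ) :
    1 - exp (-(I.card * (gaussianReal 0 1).real {y | t < |y|})) ≤
      (_root_.stdGaussian n).real {x | ∃ j ∈ I, t < |x j|} := by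
  set P := (gaussianReal 0 1).real {y | t < |y|} with hP
  have hmeas : MeasurableSet {x : Fin n → ℝ | ∃ j ∈ I, t < |x j|} := by
    have : {x : Fin n → ℝ | ∃ j ∈ I, t < |x j|} = ⋃ j ∈ I, {x | t < |x j|} := by ext; simp
    rw [this]
    exact Finset.measurableSet_biUnion _ fun j _ =>
      measurableSet_lt measurable_const (by fun_prop)
  have hm1 : MeasurableSet {y : ℝ | t < |y|} := measurableSet_lt measurable_const (by fun_prop)
  have hcompl : {x : Fin n → ℝ | ∃ j ∈ I, t < |x j|}ᶜ =
      Set.univ.pi fun j => if j ∈ I then {y : ℝ | t < |y|}ᶜ else Set.univ := by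
    ext x
    simp only [Set.mem_compl_iff, Set.mem_ofPred_eq, not_exists, not_and, Set.mem_pi, Set.mem_univ,
      true_imp_iff]
    refine forall_congr' fun j => ?_
    by_cases hj : j ∈ I <;> simp [hj]
  have h1 : (_root_.stdGaussian n).real {x : Fin n → ℝ | ∃ j ∈ I, t < |x j|}ᶜ =
      (1 - P) ^ I.card := by
    rw [hcompl, measureReal_def, _root_.stdGaussian, Measure.pi_pi, ENNReal.toReal_prod]
    have : ∀ j : Fin n, ((gaussianReal 0 1)
        (if j ∈ I then {y : ℝ | t < |y|}ᶜ else Set.univ)).toReal = if j ∈ I then 1 - P else 1 := by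
      intro j
      split_ifs
      · rw [← measureReal_def, probReal_compl_eq_one_sub hm1]
      · simp
    simp [this]
  rw [probReal_compl_eq_one_sub hmeas] at h1
  have h2 : (1 - P) ^ I.card ≤ exp (-(I.card * P)) := by
    have h3 : 0 ≤ 1 - P := by linarith [measureReal_le_one (μ := gaussianReal 0 1) (s := {y | t < |y|})]
    calc (1 - P) ^ I.card ≤ (exp (-P)) ^ I.card := by
          gcongr
          linarith [add_one_le_exp (-P)]
      _ = _ := by rw [← exp_nat_mul]; congr 1; ring
  linarith

/-- Random signs: the average of a seminorm dominates each coordinate. -/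
lemma expect_sign_ge (p : Seminorm ℝ (Fin n → ℝ)) (x : Fin n → ℝ) (j : Fin n) :
    |x j| * p (Pi.single j 1) ≤ 𝔼 r : Fin n → Bool, p (fun i => bitSign (r i) * x i) := by
  have hre : 𝔼 r : Fin n → Bool, p (fun i => bitSign (r i) * x i) =
      𝔼 r : Fin n → Bool, p (fun i => if i = j then bitSign (r i) * x i
        else -(bitSign (r i) * x i)) := by
    refine Fintype.expect_equiv (Equiv.piCongrRight fun i : Fin n =>
      if i = j then Equiv.refl Bool else Equiv.boolNot) _ _ fun r => ?_
    congr 1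
    ext i
    by_cases h : i = j
    · simp [h]
    · cases hr : r i <;> simp [h, bitSign, hr]
  have hpt : ∀ r : Fin n → Bool, 2 * (|x j| * p (Pi.single j 1)) ≤
      p (fun i => bitSign (r i) * x i) +
      p (fun i => if i = j then bitSign (r i) * x i else -(bitSign (r i) * x i)) := by
    intro r
    have h1 : p ((2 * (bitSign (r j) * x j)) • Pi.single j 1) =
        2 * (|x j| * p (Pi.single j 1)) := by
      rw [map_smul_eq_mul, Real.norm_eq_abs, abs_mul, abs_mul, abs_two]
      rcases bitSign_eq (r j) with h | h <;> rw [h] <;> simp <;> ring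
    rw [← h1]
    refine le_trans (le_of_eq ?_) (map_add_le_add p _ _)
    congr 1
    ext i
    rcases eq_or_ne i j with rfl | h
    · simp; ring
    · simp [h]
  have h2 := Finset.expect_le_expect (s := Finset.univ) fun r (_ : r ∈ Finset.univ) => hpt r
  rw [Fintype.expect_const, Finset.expect_add_distrib, ← hre] at h2
  linarith

lemma integral_expect_sign {q : Seminorm ℝ (Fin n → ℝ)} (hq : ∀ x, q x ^ 2 ≤ ∑ i, x i ^ 2) :
    Integrable (fun x => 𝔼 r : Fin n → Bool, q (fun i => bitSign (r i) * x i))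
      (_root_.stdGaussian n) ∧
    ∫ x, 𝔼 r : Fin n → Bool, q (fun i => bitSign (r i) * x i) ∂_root_.stdGaussian n =
      gaussMean q := by
  have hInteg : ∀ r : Fin n → Bool, Integrable (fun x => q (fun i => bitSign (r i) * x i))
      (_root_.stdGaussian n) := fun r =>
    (measurePreserving_sign fun i => bitSign_eq (r i)).integrable_comp_of_integrable
      (integrable_seminorm hq)
  simp only [Fintype.expect_eq_sum_div_card]
  refine ⟨(integrable_finsetSum _ fun r _ => hInteg r).div_const _, ?_⟩
  rw [integral_div, integral_finsetSum _ fun r _ => hInteg r]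
  have : ∀ r : Fin n → Bool, ∫ x, q (fun i => bitSign (r i) * x i) ∂_root_.stdGaussian n =
      gaussMean q := fun r =>
    integral_sign (fun i => bitSign_eq (r i)) q.continuous_of_finiteDimensional
  simp only [this, Finset.sum_const, nsmul_eq_mul, Finset.card_univ]
  field_simp

lemma gaussMean_ge_of_tail {p : Seminorm ℝ (Fin n → ℝ)} (hp : ∀ x, p x ^ 2 ≤ ∑ i, x i ^ 2)
    {I : Finset (Fin n)} (hI : ∀ j ∈ I, 1 / 2 ≤ p (Pi.single j 1)) {t : ℝ} (ht : 0 ≤ t) :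
    t / 2 * (_root_.stdGaussian n).real {x | ∃ j ∈ I, t < |x j|} ≤
      gaussMean (p.comp (restrictCoord I)) := by
  obtain ⟨h1, h2⟩ := integral_expect_sign (comp_restrictCoord_sq_le hp I)
  have hmeas : MeasurableSet {x : Fin n → ℝ | ∃ j ∈ I, t < |x j|} := by
    have : {x : Fin n → ℝ | ∃ j ∈ I, t < |x j|} = ⋃ j ∈ I, {x | t < |x j|} := by ext; simp
    rw [this]
    exact Finset.measurableSet_biUnion _ fun j _ =>
      measurableSet_lt measurable_const (by fun_prop)
  rw [← h2, mul_comm, ← smul_eq_mul, ← integral_indicator_const _ hmeas]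
  refine integral_mono ((integrable_const _).indicator hmeas) h1 fun x => ?_
  simp only [Set.indicator_apply, Set.mem_ofPred_eq]
  split_ifs with h
  · obtain ⟨j, hj, hlt⟩ := h
    refine le_trans ?_ (expect_sign_ge (p.comp (restrictCoord I)) x j)
    have : restrictCoord I (Pi.single j 1) = Pi.single j 1 := by
      ext i
      rcases eq_or_ne i j with rfl | hi
      · simp [restrictCoord_apply, hj]
      · simp [restrictCoord_apply, hi]
    rw [Seminorm.comp_apply, this]
    nlinarith [hI j hj]
  · exact Finset.expect_nonneg fun r _ => apply_nonneg _ _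

/-- The Gaussian mean over many large coordinates is at least of order `√(log m)`. -/
lemma log_le_gaussMean_sq {p : Seminorm ℝ (Fin n → ℝ)} (hp : ∀ x, p x ^ 2 ≤ ∑ i, x i ^ 2)
    {I : Finset (Fin n)} (hI : ∀ j ∈ I, 1 / 2 ≤ p (Pi.single j 1)) {m : ℕ} (hm : 4 ≤ log m)
    (hcard : m ≤ 2 * I.card) :
    log m ≤ 64 * gaussMean (p.comp (restrictCoord I)) ^ 2 := by
  set s := √(log m) with hs
  have hs2 : s ^ 2 = log m := Real.sq_sqrt (by linarith)
  have hs0 : 2 ≤ s := Real.le_sqrt_of_sq_le (by linarith)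
  have hmpos : (0 : ℝ) < m := by
    rcases Nat.eq_zero_or_pos m with h | h
    · rw [h] at hm; simp at hm; linarith
    · exact_mod_cast h
  have hm49 : (49 : ℝ) ≤ m := by
    have h1 : exp 4 ≤ m := (le_log_iff_exp_le hmpos).1 hm
    have h2 : exp 4 = exp 1 ^ 4 := by rw [← exp_nat_mul]; norm_num
    have h3 : (2.7 : ℝ) ^ 4 ≤ exp 1 ^ 4 := by
      gcongr
      linarith [exp_one_gt_d9]
    rw [h2] at h1
    norm_num at h3
    linarith
  have htail := gaussianReal_tail_ge (t := s - 1) (by linarith)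
  rw [sub_add_cancel, neg_div, hs2, show -(log m / 2) = -(log (√m)) by rw [log_sqrt hmpos.le],
    exp_neg, exp_log (Real.sqrt_pos.2 hmpos)] at htail
  have hA := measureReal_exists_gt_ge I (s - 1)
  have hF := gaussMean_ge_of_tail hp hI (t := s - 1) (by linarith)
  set P := (gaussianReal 0 1).real {y | s - 1 < |y|}
  have hIP : 1 ≤ I.card * P := by
    have h1 : (m : ℝ) ≤ 2 * I.card := by exact_mod_cast hcard
    have h2 : (7 : ℝ) ≤ √m := Real.le_sqrt_of_sq_le (by linarith)
    calc (1 : ℝ) ≤ √m / 6 := by linarith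
      _ = (m / 2) * ((√m)⁻¹ / 3) := by
        have h3 : (√m) ^ 2 = (m : ℝ) := Real.sq_sqrt hmpos.le
        have h4 : √(m : ℝ) ≠ 0 := by positivity
        field_simp
        rw [h3]; ring
      _ ≤ I.card * P := by gcongr; linarith
  have hexp : exp (-(I.card * P)) ≤ 1 / 2 := by
    calc exp (-(I.card * P)) ≤ exp (-1) := by gcongr
      _ ≤ 1 / 2 := by rw [exp_neg, one_div]; gcongr; linarith [exp_one_gt_d9]
  have h5 : s / 8 ≤ gaussMean (p.comp (restrictCoord I)) := by
    refine le_trans ?_ hF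
    nlinarith
  nlinarith

end LowerBound

section StableSubset

open scoped BigOperators

variable {n : ℕ}

/-- A large subset on which no coordinate contributes much to the Gaussian mean. -/
lemma exists_stable_subset (p : Seminorm ℝ (Fin n → ℝ)) {S : Finset (Fin n)} {m : ℕ}
    (hm : 0 < m) (hS : S.card = m) {L : ℝ} (hL0 : 0 < L)
    (hL : gaussMean (p.comp (restrictCoord S)) ≤ L) :
    ∃ I ⊆ S, m ≤ 2 * I.card ∧ ∀ j ∈ I, gaussMean (p.comp (restrictCoord I)) -
      gaussMean (p.comp (restrictCoord (I.erase j))) ≤ 2 * L / m := by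
  have hm' : (0 : ℝ) < m := Nat.cast_pos.2 hm
  obtain ⟨I, hI, hmin⟩ := Finset.exists_min_image S.powerset
    (fun I => gaussMean (p.comp (restrictCoord I)) - 2 * L / m * I.card)
    ⟨S, Finset.mem_powerset_self S⟩
  rw [Finset.mem_powerset] at hI
  refine ⟨I, hI, ?_, fun j hj => ?_⟩
  · have h1 := hmin S (Finset.mem_powerset_self S)
    rw [hS, div_mul_cancel₀ _ hm'.ne'] at h1
    have h2 := gaussMean_nonneg (p.comp (restrictCoord I))
    have h3 : L ≤ 2 * L / m * I.card := by linarith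
    have h4 : (m : ℝ) ≤ 2 * I.card := by
      rw [div_mul_eq_mul_div, le_div_iff₀ hm'] at h3
      nlinarith
    exact_mod_cast h4
  · have h1 := hmin (I.erase j) (Finset.mem_powerset.2 ((Finset.erase_subset _ _).trans hI))
    have h2 : ((I.erase j).card : ℝ) = I.card - 1 := by
      have := Finset.card_erase_add_one hj
      rw [eq_sub_iff_add_eq]
      exact_mod_cast this
    rw [h2] at h1
    linarith

lemma exists_subset_influence_le {p : Seminorm ℝ (Fin n → ℝ)} (hp : ∀ x, p x ^ 2 ≤ ∑ i, x i ^ 2)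
    {S : Finset (Fin n)} {N : ℕ} (hN : 0 < N) (hS : S.card = N ^ 2) {W L : ℝ}
    (hW : WidthLE p S W) (hL0 : 0 < L) (hL : gaussMean (p.comp (restrictCoord S)) ≤ L) :
    ∃ I ⊆ S, N ^ 2 ≤ 2 * I.card ∧
      ∑ j, (2 * ∫ x, |p.comp (restrictCoord I) x -
        p.comp (restrictCoord I) (Function.update x j 0)| ∂_root_.stdGaussian n) ^ 2 ≤
      68 * L * W * (log (N ^ 2 : ℕ) + 4) / N := by
  have hN' : (1 : ℝ) ≤ N := by exact_mod_cast hN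
  obtain ⟨I, hIS, hcard, hI⟩ := exists_stable_subset p (pow_pos hN 2) hS hL0 hL
  refine ⟨I, hIS, hcard, ?_⟩
  set q := p.comp (restrictCoord I) with hq
  have hq2 := comp_restrictCoord_sq_le hp I
  set a : Fin n → ℝ := fun j => ∫ x, |q x - q (Function.update x j 0)| ∂_root_.stdGaussian n
    with ha
  have hupd : ∀ j x, q (Function.update x j 0) = p.comp (restrictCoord (I.erase j)) x := by
    intro j x
    rw [hq, Seminorm.comp_apply, restrictCoord_update, Seminorm.comp_apply]
  have haj : ∀ j, a j ≤ 8.5 * L / N := by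
    intro j
    by_cases hj : j ∈ I
    · have h1 := integral_abs_update_le hq2 j hN
      simp only [← hq, hupd] at h1
      have h2 := hI j hj
      have h3 : gaussMean (p.comp (restrictCoord (I.erase j))) ≤ L :=
        (gaussMean_restrictCoord_mono hp ((Finset.erase_subset _ _).trans hIS)).trans hL
      simp only [gaussMean] at h1 h2 h3
      have h4 : a j = ∫ x, |q x - p.comp (restrictCoord (I.erase j)) x| ∂_root_.stdGaussian n := by
        simp only [ha, hupd]
      rw [h4]
      refine h1.trans ?_
      calc _ ≤ (2 * N + 1) * (2 * L / ((N ^ 2 : ℕ) : ℝ)) + 2.5 / N * L := by gcongr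
        _ ≤ (2 * N + N) * (2 * L / ((N ^ 2 : ℕ) : ℝ)) + 2.5 / N * L := by gcongr
        _ = 8.5 * L / N := by push_cast; field_simp; norm_num
    · have h1 : ∀ x, |q x - q (Function.update x j 0)| = 0 := fun x => by
        rw [hupd, Finset.erase_eq_of_notMem hj, ← hq, sub_self, abs_zero]
      have h2 : a j = 0 := by simp only [ha, h1, integral_zero]
      rw [h2]
      positivity
  have ha0 : ∀ j, 0 ≤ a j := fun j => integral_nonneg fun x => abs_nonneg _
  have hWI : WidthLE p I W := fun u hu =>
    (Finset.sum_le_sum_of_subset_of_nonneg hIS fun _ _ _ => abs_nonneg _).trans (hW u hu)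
  have hsum := sum_influence_le hp hWI (pow_pos hN 2) ((Finset.card_le_card hIS).trans hS.le) hq
  calc ∑ j, (2 * a j) ^ 2 ≤ ∑ j, 4 * (8.5 * L / N) * a j := by
        refine Finset.sum_le_sum fun j _ => ?_
        nlinarith [mul_le_mul_of_nonneg_right (haj j) (ha0 j)]
    _ = 4 * (8.5 * L / N) * ∑ j, a j := by rw [Finset.mul_sum]
    _ ≤ 4 * (8.5 * L / N) * (2 * (W * (log (N ^ 2 : ℕ) + 4))) := by gcongr
    _ = _ := by ring

lemma le_of_mul_log_div_le {V κ : ℝ} (hκ : 0 < κ)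
    (h : V * log (V / exp (-κ)) ≤ 8) : V ≤ 16 / κ := by
  by_cases hV : V ≤ exp (-κ / 2)
  · have h1 := add_one_le_exp (κ / 2)
    have h2 : exp (-κ / 2) * exp (κ / 2) = 1 := by rw [← exp_add]; ring_nf; simp
    rw [le_div_iff₀ hκ]
    nlinarith [exp_pos (-κ / 2)]
  · push Not at hV
    have hV0 : 0 < V := (exp_pos _).trans hV
    have h1 : κ / 2 ≤ log (V / exp (-κ)) := by
      rw [log_div hV0.ne' (exp_pos _).ne', log_exp]
      have := log_le_log (exp_pos _) hV.le
      rw [log_exp] at this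
      linarith
    rw [le_div_iff₀ hκ]
    nlinarith

open Filter Topology in
lemma eventually_influence_lt (c : ℝ) : ∀ᶠ κ : ℕ in atTop,
    68 * (5 + 4 * κ) * (1 + 2 * ((5 + 4 * κ) / c)) * (2 * κ + 4) / 2 ^ κ <
      exp (-(κ * (log 2 / 2))) := by
  have hr : exp (log 2 / 2) / 2 < 1 := by
    have h1 : exp (log 2 / 2) < exp (log 2) := exp_lt_exp.2 (by linarith [log_pos one_lt_two])
    rw [exp_log two_pos] at h1
    linarith
  set r := exp (log 2 / 2) / 2 with hr'
  have hr0 : 0 < r := by positivity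
  have ht : ∀ k : ℕ, Tendsto (fun κ : ℕ => (κ : ℝ) ^ k * r ^ κ) atTop (𝓝 0) := fun k =>
    tendsto_pow_const_mul_const_pow_of_lt_one k hr0.le hr
  have h0 := (((ht 0).const_mul (68 * 5 * 4 * (1 + 10 / c))).add
    ((ht 1).const_mul (68 * ((4 * 4 + 5 * 2) * (1 + 10 / c) + 20 * (8 / c))))).add
    (((ht 2).const_mul (68 * (8 * (1 + 10 / c) + 26 * (8 / c)))).add
    ((ht 3).const_mul (68 * 8 * (8 / c))))
  simp only [mul_zero, add_zero] at h0
  filter_upwards [h0.eventually_lt_const one_pos] with κ hκ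
  have h2 : r ^ κ = exp (κ * (log 2 / 2)) / 2 ^ κ := by rw [hr', div_pow, exp_nat_mul]
  have h3 : exp (-(κ * (log 2 / 2))) * exp (κ * (log 2 / 2)) = 1 := by rw [← exp_add]; simp
  rw [← mul_lt_mul_iff_left₀ (exp_pos (κ * (log 2 / 2))), h3]
  refine lt_of_eq_of_lt ?_ hκ
  rw [h2]
  ring

end StableSubset

section GoodSubset

open scoped BigOperators

variable {n : ℕ}

lemma gaussMean_restrictCoord_ge {p : Seminorm ℝ (Fin n → ℝ)} (hp : ∀ x, p x ^ 2 ≤ ∑ i, x i ^ 2)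
    {I : Finset (Fin n)} {j : Fin n} (hjI : j ∈ I) (hj : 1 / 2 ≤ p (Pi.single j 1)) :
    gaussAbsMoment / 2 ≤ gaussMean (p.comp (restrictCoord I)) :=
  (gaussMean_singleton_ge hj).trans
    (gaussMean_restrictCoord_mono hp (Finset.singleton_subset_iff.2 hjI))

lemma log_le_of_lt_pow {κ : ℕ} (hn : 2 ≤ n) (h : n < 2 * 16 ^ (κ + 1)) : log n ≤ 5 + 4 * κ := by
  have hn' : (0 : ℝ) < n := by positivity
  have h1 : (n : ℝ) ≤ 2 ^ (5 + 4 * κ) := by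
    have : n ≤ 2 ^ (5 + 4 * κ) := by
      rw [pow_add, pow_mul]
      rw [pow_succ] at h
      norm_num
      linarith
    exact_mod_cast this
  calc log n ≤ log (2 ^ (5 + 4 * κ)) := log_le_log hn' h1
    _ = (5 + 4 * κ) * log 2 := by rw [log_pow]; push_cast; ring
    _ ≤ (5 + 4 * κ) * 1 := by gcongr; linarith [log_two_lt_d9]
    _ = _ := mul_one _

/-- In a good position, some coordinate section has small normalized variance. -/
lemma exists_good_subset : ∃ C > (0 : ℝ), ∀ n : ℕ, 2 ≤ n → ∀ p : Seminorm ℝ (Fin n → ℝ),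
    (∀ x, p x ^ 2 ≤ ∑ i, x i ^ 2) → ∀ J : Finset (Fin n), n ≤ 2 * J.card →
    (∀ j ∈ J, 1 / 2 ≤ p (Pi.single j 1)) →
    ∃ I : Finset (Fin n), 0 < gaussMean (p.comp (restrictCoord I)) ∧
      gaussVar (p.comp (restrictCoord I)) * log n ^ 2 ≤
        C * gaussMean (p.comp (restrictCoord I)) ^ 2 := by
  have hc := gaussAbsMoment_pos
  set c := gaussAbsMoment with hcdef
  obtain ⟨κ₀, hκ₀⟩ := Filter.eventually_atTop.1 (eventually_influence_lt c)
  refine ⟨8 * (5 + 4 * κ₀ + 20) ^ 2 / c ^ 2 + 331776, by positivity, ?_⟩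
  intro n hn p hp J hJ hpJ
  have hlog : 0 ≤ log n := log_natCast_nonneg n
  set κ := Nat.log 16 (n / 2) with hκ
  have hκ1 : 16 ^ κ ≤ n / 2 := Nat.pow_log_le_self 16 (by omega)
  have hκ2 : n / 2 < 16 ^ (κ + 1) := Nat.lt_pow_succ_log_self (by norm_num) _
  have hlogn := log_le_of_lt_pow (κ := κ) hn (by omega)
  by_cases hsmall : κ ≤ κ₀ + 4
  · obtain ⟨j, hj⟩ : J.Nonempty := Finset.card_pos.1 (by omega)
    have hF := gaussMean_restrictCoord_ge hp (Finset.mem_singleton_self j) (hpJ j hj)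
    have hV := gaussVar_le_two (comp_restrictCoord_sq_le hp {j})
    refine ⟨{j}, by linarith, ?_⟩
    set F := gaussMean (p.comp (restrictCoord {j}))
    have hκ' : (κ : ℝ) ≤ κ₀ + 4 := by exact_mod_cast hsmall
    calc _ ≤ 2 * log n ^ 2 := by gcongr
      _ ≤ 2 * (5 + 4 * κ₀ + 20) ^ 2 := by gcongr; linarith
      _ = 8 * (5 + 4 * κ₀ + 20) ^ 2 / c ^ 2 * (c / 2) ^ 2 := by field_simp; ring
      _ ≤ 8 * (5 + 4 * κ₀ + 20) ^ 2 / c ^ 2 * F ^ 2 := by gcongr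
      _ ≤ _ := by gcongr; linarith
  have hκκ₀ : κ₀ ≤ κ := by omega
  have hκ4 : 4 ≤ κ := by omega
  have hκ4' : (4 : ℝ) ≤ κ := by exact_mod_cast hκ4
  obtain ⟨J', hJ'J, hJ'⟩ := Finset.exists_subset_card_eq (s := J) (n := 16 ^ κ) (by omega)
  have hC : ∀ F : ℝ, 331776 * F ^ 2 ≤ (8 * (5 + 4 * κ₀ + 20) ^ 2 / c ^ 2 + 331776) * F ^ 2 :=
    fun F => by gcongr; linarith [show 0 ≤ 8 * (5 + 4 * (κ₀ : ℝ) + 20) ^ 2 / c ^ 2 by positivity]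
  set L := gaussMean (p.comp (restrictCoord J')) with hL
  have hL0 : 0 < L := by
    obtain ⟨j, hj⟩ : J'.Nonempty := Finset.card_pos.1 (by rw [hJ']; positivity)
    linarith [gaussMean_restrictCoord_ge hp hj (hpJ j (hJ'J hj))]
  by_cases hcase : log n ≤ L
  · refine ⟨J', hL0, le_trans ?_ (hC L)⟩
    have hV := gaussVar_le_two (comp_restrictCoord_sq_le hp J')
    calc _ ≤ 2 * log n ^ 2 := by gcongr
      _ ≤ 2 * L ^ 2 := by gcongr
      _ ≤ _ := by nlinarith [sq_nonneg L]
  push Not at hcase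
  have hL1 : L ≤ 5 + 4 * κ := hcase.le.trans hlogn
  have h16 : (16 : ℕ) ^ κ = 2 ^ (2 * κ) * 2 ^ (2 * κ) := by
    rw [← pow_add, show 2 * κ + 2 * κ = 4 * κ by ring, pow_mul]; norm_num
  have hsqrt : √(J'.card : ℝ) = 2 ^ (2 * κ) := by
    rw [hJ', h16]
    push_cast
    exact Real.sqrt_mul_self (by positivity)
  obtain ⟨S, hSJ', hS, hW⟩ := exists_subset_widthLE hp (2 ^ (2 * κ)) (2 * κ) J' _
    (by rw [hJ', h16]) hL.le (WidthLE.of_card hp J')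
  rw [hsqrt, div_self (by positivity)] at hW
  set W := 1 + 2 * (L / gaussAbsMoment) * (1 - 1 / (2 : ℝ) ^ (2 * κ)) with hWdef
  have hWle : W ≤ 1 + 2 * ((5 + 4 * κ) / c) := by
    have h1 : 0 ≤ 1 / (2 : ℝ) ^ (2 * κ) := by positivity
    have h2 : L / c ≤ (5 + 4 * κ) / c := by gcongr
    have h3 : 0 ≤ L / c := by positivity
    rw [hWdef]
    nlinarith
  have hS2 : S.card = (2 ^ κ) ^ 2 := by rw [hS, ← pow_mul, mul_comm]
  obtain ⟨I, hIS, hcard, hinf⟩ := exists_subset_influence_le hp (pow_pos two_pos κ) hS2 hW hL0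
    (gaussMean_restrictCoord_mono hp hSJ')
  have hIJ : ∀ j ∈ I, 1 / 2 ≤ p (Pi.single j 1) := fun j hj => hpJ j (hJ'J (hSJ' (hIS hj)))
  have hlogm : log (((2 ^ κ) ^ 2 : ℕ) : ℝ) = 2 * κ * log 2 := by
    push_cast
    rw [← pow_mul, log_pow]; push_cast; ring
  have hl2 := log_two_gt_d9
  have hl2' := log_two_lt_d9
  have hκ0 : (0 : ℝ) ≤ κ := by linarith
  have hF := log_le_gaussMean_sq hp hIJ (m := (2 ^ κ) ^ 2) (by rw [hlogm]; nlinarith) hcard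
  rw [hlogm] at hF hinf
  have hlt := lt_of_le_of_lt hinf (lt_of_le_of_lt ?_ (hκ₀ κ hκκ₀))
  · have hV := gaussVar_talagrand (comp_restrictCoord_sq_le hp I) (exp_pos _) hlt
    have hV2 := le_of_mul_log_div_le (by nlinarith) hV
    have hF0 : 0 < gaussMean (p.comp (restrictCoord I)) := by
      obtain ⟨j, hj⟩ : I.Nonempty := Finset.card_pos.1 (by
        have : 0 < (2 ^ κ) ^ 2 := by positivity
        omega)
      linarith [gaussMean_restrictCoord_ge hp hj (hIJ j hj)]
    refine ⟨I, hF0, le_trans ?_ (hC _)⟩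
    have hV3 : gaussVar (p.comp (restrictCoord I)) ≤ 64 / κ := by
      refine hV2.trans ?_
      rw [div_le_div_iff₀ (by nlinarith) (by linarith)]
      nlinarith
    calc _ ≤ 64 / κ * log n ^ 2 := by gcongr
      _ ≤ 64 / κ * (9 * κ) ^ 2 := by gcongr; linarith
      _ = 5184 * κ := by field_simp; norm_num
      _ ≤ _ := by nlinarith
  · have hW0 : 0 ≤ W := by
      have h1 : 1 / (2 : ℝ) ^ (2 * κ) ≤ 1 := by
        rw [div_le_one (by positivity)]; exact one_le_pow₀ one_le_two
      have h2 : 0 ≤ 1 - 1 / (2 : ℝ) ^ (2 * κ) := by linarith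
      positivity
    push_cast
    gcongr 68 * ?_ * ?_ * (?_ + 4) / _
    nlinarith

end GoodSubset

section Perturbation

open scoped BigOperators
open Filter Topology

variable {n : ℕ}

/-- The diagonal map equal to `1` on `I` and to `ε` off `I`. -/
noncomputable def coordScaling (I : Finset (Fin n)) (ε : ℝ) (hε : ε ≠ 0) :
    (Fin n → ℝ) ≃ₗ[ℝ] (Fin n → ℝ) :=
  LinearEquiv.piCongrRight fun i =>
    LinearEquiv.smulOfNeZero ℝ ℝ (if i ∈ I then 1 else ε) (by split_ifs <;> simp [hε])

lemma coordScaling_apply (I : Finset (Fin n)) (ε : ℝ) (hε : ε ≠ 0) (x : Fin n → ℝ) (i : Fin n) :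
    coordScaling I ε hε x i = (if i ∈ I then 1 else ε) * x i := rfl

lemma sum_sq_coordScaling_le (I : Finset (Fin n)) {ε : ℝ} (hε : ε ≠ 0) (h : |ε| ≤ 1)
    (x : Fin n → ℝ) : ∑ i, coordScaling I ε hε x i ^ 2 ≤ ∑ i, x i ^ 2 := by
  refine Finset.sum_le_sum fun i _ => ?_
  have h2 : ε ^ 2 ≤ 1 := (sq_le_one_iff_abs_le_one ε).2 h
  rw [coordScaling_apply]
  split_ifs
  · simp
  · rw [mul_pow]; nlinarith [sq_nonneg (x i)]

lemma tendsto_coordScaling (I : Finset (Fin n)) {ε : ℕ → ℝ} (hε : ∀ k, ε k ≠ 0)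
    (h : Tendsto ε atTop (𝓝 0)) (x : Fin n → ℝ) :
    Tendsto (fun k => coordScaling I (ε k) (hε k) x) atTop (𝓝 (restrictCoord I x)) := by
  refine tendsto_pi_nhds.2 fun i => ?_
  simp only [coordScaling_apply, restrictCoord_apply]
  split_ifs
  · simp
  · simpa using h.mul_const (x i)

lemma tendsto_integral_coordScaling {φ : (Fin n → ℝ) → ℝ} (hφ : Continuous φ)
    (hb : ∀ x, |φ x| ≤ 1 + ∑ i, x i ^ 2) (I : Finset (Fin n)) {ε : ℕ → ℝ} (hε : ∀ k, ε k ≠ 0)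
    (hε1 : ∀ k, |ε k| ≤ 1) (h : Tendsto ε atTop (𝓝 0)) :
    Tendsto (fun k => ∫ x, φ (coordScaling I (ε k) (hε k) x) ∂_root_.stdGaussian n) atTop
      (𝓝 (∫ x, φ (restrictCoord I x) ∂_root_.stdGaussian n)) := by
  have hInteg : Integrable (fun x : Fin n → ℝ => 1 + ∑ i, x i ^ 2) (_root_.stdGaussian n) :=
    integrable_stdGaussian (by fun_prop) fun x => by
      rw [abs_of_nonneg]
      have : 0 ≤ ∑ i, x i ^ 2 := Finset.sum_nonneg fun i _ => sq_nonneg _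
      linarith
  refine tendsto_integral_of_dominated_convergence (fun x => 1 + ∑ i, x i ^ 2) (fun k => ?_) hInteg
    (fun k => ae_of_all _ fun x => ?_)
    (ae_of_all _ fun x => (hφ.tendsto _).comp (tendsto_coordScaling I hε h x))
  · have : Continuous (coordScaling I (ε k) (hε k)) :=
      LinearMap.continuous_of_finiteDimensional (coordScaling I (ε k) (hε k)).toLinearMap
    exact (hφ.comp this).aestronglyMeasurable
  · rw [Real.norm_eq_abs]
    linarith [hb (coordScaling I (ε k) (hε k) x), sum_sq_coordScaling_le I (hε k) (hε1 k) x]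

/-- A strict bound for a coordinate section passes to an invertible perturbation. -/
lemma exists_coordScaling_of_section {p : Seminorm ℝ (Fin n → ℝ)}
    (hp : ∀ x, p x ^ 2 ≤ ∑ i, x i ^ 2) {I : Finset (Fin n)} {a b : ℝ}
    (h : gaussVar (p.comp (restrictCoord I)) * a <
      b * gaussMean (p.comp (restrictCoord I)) ^ 2) :
    ∃ D : (Fin n → ℝ) ≃ₗ[ℝ] (Fin n → ℝ),
      ((∫ x, p (D x) ^ 2 ∂_root_.stdGaussian n) - (∫ x, p (D x) ∂_root_.stdGaussian n) ^ 2) * a <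
      b * (∫ x, p (D x) ∂_root_.stdGaussian n) ^ 2 := by
  have hc := p.continuous_of_finiteDimensional
  have hε : ∀ k : ℕ, 1 / ((k : ℝ) + 1) ≠ 0 := fun k => by positivity
  have hε1 : ∀ k : ℕ, |1 / ((k : ℝ) + 1)| ≤ 1 := fun k => by
    rw [abs_of_nonneg (by positivity), div_le_one (by positivity)]
    linarith [(Nat.cast_nonneg k : (0 : ℝ) ≤ k)]
  have h1 := tendsto_integral_coordScaling hc (abs_seminorm_le hp) I hε hε1
    tendsto_one_div_add_atTop_nhds_zero_nat
  have h2 := tendsto_integral_coordScaling (hc.pow 2) (abs_seminorm_sq_le hp) I hε hε1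
    tendsto_one_div_add_atTop_nhds_zero_nat
  obtain ⟨k, hk⟩ := (((h2.sub (h1.pow 2)).mul_const a).eventually_lt ((h1.pow 2).const_mul b)
    h).exists
  exact ⟨_, hk⟩

end Perturbation

/-- For every normed space `X = (ℝⁿ, N)`, `n ≥ 2`, there is an invertible linear map
`T` with `Var(N(TG)) ≤ C (E N(TG))² / (log n)²`; i.e. `𝔅(X) ≤ C/(log n)²`. -/
theorem statement19 :
    ∃ C > (0 : ℝ), ∀ n : ℕ, 2 ≤ n →
      ∀ N : (Fin n → ℝ) → ℝ,
        (∀ x y, N (x + y) ≤ N x + N y) →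
        (∀ (r : ℝ) (x), N (r • x) = |r| * N x) →
        (∀ x, N x = 0 → x = 0) →
        ∃ T : (Fin n → ℝ) ≃ₗ[ℝ] (Fin n → ℝ),
          (∫ x, (N (T x)) ^ 2 ∂stdGaussian n) - (∫ x, N (T x) ∂stdGaussian n) ^ 2
            ≤ C * (∫ x, N (T x) ∂stdGaussian n) ^ 2 / (Real.log n) ^ 2 := by
  obtain ⟨C, hC, h⟩ := exists_good_subset
  refine ⟨C + 1, by linarith, fun n hn N hadd hsmul hdef => ?_⟩
  set p : Seminorm ℝ (Fin n → ℝ) := Seminorm.of N hadd hsmul with hp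
  obtain ⟨T, J, hJ, hT, hpJ⟩ := exists_position (by omega) p hdef
  obtain ⟨I, hF, hV⟩ := h n hn (p.comp T.toLinearMap) hT J hJ hpJ
  obtain ⟨D, hD⟩ := exists_coordScaling_of_section (p := p.comp T.toLinearMap) hT (I := I)
    (a := log n ^ 2) (b := C + 1) (by nlinarith [pow_pos hF 2])
  refine ⟨D.trans T, ?_⟩
  rw [le_div_iff₀ (pow_pos (log_pos (by exact_mod_cast hn)) 2)]
  exact hD.le
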